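/- Let G be a countably infinite group and let (L, λ) be a finite probability space. If rh_G(L^G, λ^G) = H(L, λ), then the Bernoulli measure λ^G on L^G is finitely determined. -/

import Mathlib

open MeasureTheory
open scoped ENNReal symmDiff

/-- A countable ordered Borel partition of `X` (empty pieces allowed). -/
structure CtblPart (X : Type*) [MeasurableSpace X] where
  piece : ℕ → Set X
  measurable : ∀ i, MeasurableSet (piece i)
  disj : Pairwise fun i j => Disjoint (piece i) (piece j)
  cover : (⋃ i, piece i) = Set.univ

/-- The σ-algebra `m` equals the ambient (Borel) σ-algebra modulo `μ`-null sets. -/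
def SpansModNull {X : Type*} (m : MeasurableSpace X) [mX : MeasurableSpace X]
    (μ : Measure X) : Prop :=
  ∀ s : Set X, MeasurableSet s → ∃ t : Set X, MeasurableSet[m] t ∧ μ (s ∆ t) = 0

/-- The conditional Shannon entropy `H_μ(α | m)`. -/
noncomputable def condEnt {X : Type*} (m : MeasurableSpace X) [mX : MeasurableSpace X]
    (μ : Measure X) (α : CtblPart X) : ℝ≥0∞ :=
  ∫⁻ x, ENNReal.ofReal (∑' i, -(α.piece i).indicator (fun _ => (1 : ℝ)) x *
      Real.log ((μ[(α.piece i).indicator (fun _ => (1 : ℝ))|m]) x)) ∂μ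

/-- `|a − b|` for extended nonnegative reals. -/
noncomputable def ediff (a b : ℝ≥0∞) : ℝ≥0∞ := (a - b) + (b - a)

/-- The Bernoulli shift action of `G` on `L^G`: `(g • x)(t) = x(g⁻¹ t)`. -/
def shiftAct {G L : Type*} [Group G] (g : G) (x : G → L) : G → L :=
  fun t => x (g⁻¹ * t)

/-- `ν` is the Bernoulli product measure `λ^G` on `L^G`. -/
def IsBernoulliProd {G L : Type*} [MeasurableSpace L] (lam : Measure L)
    (ν : Measure (G → L)) : Prop :=
  IsProbabilityMeasure ν ∧
    ∀ (s : Finset G) (f : G → Set L), (∀ g, MeasurableSet (f g)) →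
      ν {x | ∀ g ∈ s, x g ∈ f g} = ∏ g ∈ s, lam (f g)

/-- The smallest shift-invariant σ-algebra on `L^G` containing the collection `C`. -/
def sigmaShift (G : Type*) {L : Type*} [Group G] [MeasurableSpace L]
    (C : Set (Set (G → L))) : MeasurableSpace (G → L) :=
  MeasurableSpace.generateFrom {s | ∃ (g : G) (t : Set (G → L)), t ∈ C ∧ s = shiftAct g ⁻¹' t}

/-- The σ-algebra `I_G` of shift-invariant Borel subsets of `L^G`. -/
def shiftInvSigma (G L : Type*) [Group G] [MeasurableSpace L] : MeasurableSpace (G → L) :=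
  MeasurableSpace.generateFrom {s | MeasurableSet s ∧ ∀ g : G, shiftAct g ⁻¹' s = s}

/-- The Rokhlin entropy of `(L^G, ν)` (non-ergodic definition): the infimum of
`H_ν(α | I_G)` over countable partitions `α` with `σ_G(α) ∨ I_G = Borel` mod `ν`-null sets. -/
noncomputable def rokhlinShift (G : Type*) {L : Type*} [Group G] [MeasurableSpace L]
    (ν : Measure (G → L)) : ℝ≥0∞ :=
  ⨅ (α : CtblPart (G → L))
    (_ : SpansModNull (sigmaShift G (Set.range α.piece) ⊔ shiftInvSigma G L) ν),
    condEnt (shiftInvSigma G L) ν α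

/-- The stabilizer map `L^G → Sub(G)` of the shift action. -/
def stabMap (G L : Type*) [Group G] : (G → L) → Set G :=
  fun x => {g | shiftAct g x = x}

/-- `lam` is a joining of the shift-invariant measures `μ` and `ν` on `L^G`. -/
def IsJoining (G : Type*) {L : Type*} [Group G] [MeasurableSpace L]
    (lam : Measure ((G → L) × (G → L))) (μ ν : Measure (G → L)) : Prop :=
  (∀ g : G, MeasurePreserving (fun z : (G → L) × (G → L) =>
      (shiftAct g z.1, shiftAct g z.2)) lam lam) ∧
    Measure.map Prod.fst lam = μ ∧ Measure.map Prod.snd lam = ν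

/-- The d-bar distance between two shift-invariant measures on `L^G`: the infimal probability
of disagreement at the identity coordinate over all joinings. -/
noncomputable def dbar (G : Type*) {L : Type*} [Group G] [MeasurableSpace L]
    (μ ν : Measure (G → L)) : ℝ≥0∞ :=
  ⨅ (lam : Measure ((G → L) × (G → L))) (_ : IsJoining G lam μ ν),
    lam {z | z.1 (1 : G) ≠ z.2 (1 : G)}

/-! ### The shift action -/

theorem shiftAct_one {G L : Type*} [Group G] (x : G → L) : shiftAct 1 x = x := by
  funext t; simp [shiftAct]

theorem shiftAct_mul {G L : Type*} [Group G] (g h : G) (x : G → L) :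
    shiftAct (g * h) x = shiftAct g (shiftAct h x) := by
  funext t; simp [shiftAct, mul_assoc]

theorem shiftAct_injective {G L : Type*} [Group G] (g : G) :
    Function.Injective (shiftAct g : (G → L) → G → L) := by
  intro x y hxy
  have := congrArg (shiftAct g⁻¹) hxy
  simpa [← shiftAct_mul, shiftAct_one] using this

@[fun_prop]
theorem measurable_shiftAct {G L : Type*} [Group G] [MeasurableSpace L] (g : G) :
    Measurable (shiftAct g : (G → L) → G → L) :=
  measurable_pi_lambda _ fun t => measurable_pi_apply (g⁻¹ * t)

theorem ae_forall_shiftAct {G L : Type*} [Group G] [Countable G] [MeasurableSpace L]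
    {μ : Measure (G → L)} (hinv : ∀ g : G, MeasurePreserving (shiftAct g) μ μ)
    {p : (G → L) → Prop} (hp : ∀ᵐ x ∂μ, p x) : ∀ᵐ x ∂μ, ∀ g : G, p (shiftAct g x) := by
  rw [ae_all_iff]
  exact fun g => (hinv g).quasiMeasurePreserving.ae hp

/-! ### Marker sets -/

/-- The points at which `f` is within `ε` of its infimum over the orbit. -/
def markerSet {G L : Type*} [Group G] (f : (G → L) → ℝ) (ε : ℝ) : Set (G → L) :=
  {x | ∀ g : G, f x < f (shiftAct g x) + ε}

theorem measurableSet_markerSet {G L : Type*} [Group G] [Countable G] [MeasurableSpace L]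
    {f : (G → L) → ℝ} (hf : Measurable f) (ε : ℝ) : MeasurableSet (markerSet f ε) := by
  have : markerSet f ε = ⋂ g : G, {x | f x < f (shiftAct g x) + ε} := by
    ext x; simp [markerSet]
  rw [this]
  exact MeasurableSet.iInter fun g =>
    measurableSet_lt hf ((hf.comp (measurable_shiftAct g)).add_const ε)

theorem markerSet_mono {G L : Type*} [Group G] (f : (G → L) → ℝ) {ε ε' : ℝ} (h : ε ≤ ε') :
    markerSet f ε ⊆ markerSet f ε' :=
  fun _ hx g => (hx g).trans_le (by gcongr)

theorem exists_shiftAct_mem_markerSet {G L : Type*} [Group G] {f : (G → L) → ℝ}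
    (hf : ∀ x, 0 ≤ f x) {ε : ℝ} (hε : 0 < ε) (x : G → L) :
    ∃ g : G, shiftAct g x ∈ markerSet f ε := by
  have hbdd : BddBelow (Set.range fun g : G => f (shiftAct g x)) :=
    ⟨0, by rintro _ ⟨g, rfl⟩; exact hf _⟩
  obtain ⟨g, hg⟩ := exists_lt_of_ciInf_lt
    (lt_add_of_pos_right (⨅ g : G, f (shiftAct g x)) hε)
  refine ⟨g, fun h => ?_⟩
  rw [← shiftAct_mul]
  have := ciInf_le hbdd (h * g)
  linarith

theorem exists_measure_markerSet_lt {G L : Type*} [Group G] [Countable G] [Infinite G]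
    [MeasurableSpace L] {μ : Measure (G → L)} [IsFiniteMeasure μ]
    (hinv : ∀ g : G, MeasurePreserving (shiftAct g) μ μ) {f : (G → L) → ℝ} (hf : Measurable f)
    (hsep : ∀ g : G, g ≠ 1 → ∀ᵐ x ∂μ, f (shiftAct g x) ≠ f x) {θ : ℝ≥0∞} (hθ : θ ≠ 0) :
    ∃ ε : ℝ, 0 < ε ∧ μ (markerSet f ε) < θ := by
  set M : Set (G → L) := ⋂ n : ℕ, markerSet f (1 / (n + 1 : ℝ)) with hM
  have hMmeas : MeasurableSet M :=
    MeasurableSet.iInter fun n => measurableSet_markerSet hf _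
  have hMle : ∀ x ∈ M, ∀ g : G, f x ≤ f (shiftAct g x) := by
    intro x hx g
    refine le_of_forall_pos_lt_add fun ε hε => ?_
    obtain ⟨n, hn⟩ := exists_nat_one_div_lt hε
    have := Set.mem_iInter.1 hx n g
    linarith
  have hM0 : μ M = 0 := by
    have hdisj : Pairwise fun g h : G =>
        AEDisjoint μ (shiftAct g ⁻¹' M) (shiftAct h ⁻¹' M) := by
      intro g h hgh
      have h1 : g * h⁻¹ ≠ 1 := fun h0 => hgh (mul_inv_eq_one.1 h0)
      have h2 := (hinv h).quasiMeasurePreserving.ae (hsep _ h1)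
      refine measure_mono_null ?_ h2
      rintro x ⟨hx1, hx2⟩ hne
      apply hne
      refine le_antisymm ?_ (hMle _ hx2 _)
      have := hMle _ hx1 (h * g⁻¹)
      rw [← shiftAct_mul] at this ⊢
      simpa using this
    have hsum := measure_iUnion₀ hdisj
      fun g => ((measurable_shiftAct g) hMmeas).nullMeasurableSet
    simp_rw [fun g : G => (hinv g).measure_preimage hMmeas.nullMeasurableSet] at hsum
    by_contra h0
    rw [ENNReal.tsum_const_eq_top_of_ne_zero h0] at hsum
    exact measure_ne_top _ _ hsum
  have hanti : Antitone fun n : ℕ => markerSet f (1 / (n + 1 : ℝ)) :=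
    fun m n hmn => markerSet_mono f (Nat.one_div_le_one_div hmn)
  have hlim := tendsto_measure_iInter_atTop (μ := μ)
    (fun n : ℕ => (measurableSet_markerSet hf (1 / (n + 1 : ℝ))).nullMeasurableSet) hanti
    ⟨0, measure_ne_top _ _⟩
  rw [← hM, hM0] at hlim
  obtain ⟨n, hn⟩ := (hlim.eventually_lt_const (pos_iff_ne_zero.2 hθ)).exists
  exact ⟨1 / (n + 1 : ℝ), by positivity, hn⟩

/-- A measurable choice of a group element moving each point into a set meeting every orbit,
depending only on the visits to that set. -/
theorem exists_measurable_return {G L : Type*} [Group G] [Countable G] [MeasurableSpace L]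
    {R : Set (G → L)} (hR : MeasurableSet R) (hmeet : ∀ x, ∃ g : G, shiftAct g x ∈ R) :
    ∃ c : (G → L) → G, (∀ g, MeasurableSet {x | c x = g}) ∧ (∀ x, shiftAct (c x) x ∈ R) ∧
      ∀ x x', (∀ g : G, shiftAct g x ∈ R ↔ shiftAct g x' ∈ R) → c x = c x' := by
  classical
  obtain ⟨e, he⟩ := exists_surjective_nat G
  have hex : ∀ x, ∃ n, shiftAct (e n) x ∈ R := fun x => by
    obtain ⟨g, hg⟩ := hmeet x
    obtain ⟨n, rfl⟩ := he g
    exact ⟨n, hg⟩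
  have hmeas : Measurable fun x => Nat.find (hex x) :=
    measurable_find hex fun n => (measurable_shiftAct (e n)) hR
  refine ⟨fun x => e (Nat.find (hex x)), fun g => ?_, fun x => Nat.find_spec (hex x), ?_⟩
  · exact hmeas (show MeasurableSet {n | e n = g} from MeasurableSet.of_discrete)
  · intro x x' h
    exact congrArg e (Nat.find_congr' fun {n} => h (e n))

theorem lintegral_tsum_return {G L : Type*} [Group G] [Countable G] [MeasurableSpace L]
    {μ : Measure (G → L)} (hinv : ∀ g : G, MeasurePreserving (shiftAct g) μ μ)
    {c : (G → L) → G} (hc : ∀ g, MeasurableSet {x | c x = g})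
    {F : (G → L) → ℝ≥0∞} (hF : Measurable F) :
    ∫⁻ x, ∑' g : G, {y | c y = g⁻¹}.indicator F (shiftAct g x) ∂μ = ∫⁻ x, F x ∂μ := by
  have hm : ∀ g : G, Measurable ({y | c y = g⁻¹}.indicator F) := fun g => hF.indicator (hc _)
  rw [lintegral_tsum (f := fun (g : G) x => {y | c y = g⁻¹}.indicator F (shiftAct g x))
    fun g => ((hm g).comp (measurable_shiftAct g)).aemeasurable]
  simp_rw [fun g : G => (hinv g).lintegral_comp (hm g)]
  rw [← lintegral_tsum fun g => (hm g).aemeasurable]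
  refine lintegral_congr fun x => ?_
  rw [tsum_eq_single (c x)⁻¹]
  · simp
  · intro g hg
    apply Set.indicator_of_notMem
    intro h
    apply hg
    have h' : c x = g⁻¹ := h
    rw [h', inv_inv]

theorem ae_finite_return {G L : Type*} [Group G] [Countable G] [MeasurableSpace L]
    {μ : Measure (G → L)} [IsFiniteMeasure μ]
    (hinv : ∀ g : G, MeasurePreserving (shiftAct g) μ μ)
    {c : (G → L) → G} (hc : ∀ g, MeasurableSet {x | c x = g}) :
    ∀ᵐ x ∂μ, {g : G | c (shiftAct g x) = g⁻¹}.Finite := by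
  have h1 := lintegral_tsum_return hinv hc (F := fun _ => 1) measurable_const
  have hmeas : Measurable fun x =>
      ∑' g : G, {y | c y = g⁻¹}.indicator (fun _ => (1 : ℝ≥0∞)) (shiftAct g x) :=
    Measurable.tsum fun g =>
      ((measurable_const.indicator (hc g⁻¹)).comp (measurable_shiftAct g))
  filter_upwards [ae_lt_top hmeas (by rw [h1]; simp)] with x hx
  refine (ENNReal.finite_const_le_of_tsum_ne_top hx.ne one_ne_zero).subset fun g hg => ?_
  have hg' : c (shiftAct g x) = g⁻¹ := hg
  simp [Set.indicator, hg']

/-! ### Separating labels with few values -/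

theorem card_filter_apply_eq_mul_le {P : Type*} [Fintype P] [DecidableEq P] (K : ℕ) {p q : P}
    (hpq : p ≠ q) :
    (Finset.univ.filter fun f : P → Fin (K + 1) => f p = f q).card * (K + 1) ≤
      Fintype.card (P → Fin (K + 1)) := by
  have hprod : (Finset.univ.filter fun f : P → Fin (K + 1) => f p = f q).card * (K + 1) =
      ((Finset.univ.filter fun f : P → Fin (K + 1) => f p = f q) ×ˢ
        (Finset.univ : Finset (Fin (K + 1)))).card := by
    rw [Finset.card_product, Finset.card_univ, Fintype.card_fin]
  rw [hprod, ← Finset.card_univ]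
  refine Finset.card_le_card_of_injOn (fun z => Function.update z.1 p z.2) (by simp) ?_
  rintro ⟨f, k⟩ hf ⟨f', k'⟩ hf' h
  simp only [Finset.coe_product, Set.mem_prod, Finset.mem_coe, Finset.mem_filter,
    Finset.mem_univ, true_and, and_true] at hf hf' h
  have hk : k = k' := by simpa using congrFun h p
  have hne : ∀ t, t ≠ p → f t = f' t := fun t ht => by simpa [ht] using congrFun h t
  refine Prod.ext (funext fun t => ?_) hk
  by_cases ht : t = p
  · subst ht
    change f t = f' t
    rw [hf, hf', hne q hpq.symm]
  · exact hne t ht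

theorem exists_finite_label_separating {Ω Y : Type*} [MeasurableSpace Ω] [MeasurableSpace Y]
    [StandardBorelSpace Y] {ν : Measure Ω} [IsProbabilityMeasure ν] {φ ψ : Ω → Y}
    (hφ : Measurable φ) (hψ : Measurable ψ) (hne : ∀ᵐ x ∂ν, φ x ≠ ψ x) (K : ℕ) :
    ∃ u : Y → Fin (K + 1), Measurable u ∧ ν {x | u (φ x) = u (ψ x)} ≤ 2 / (K + 1) := by
  classical
  set e : Y → ℕ → Bool := MeasurableSpace.mapNatBool Y with he
  have hem : Measurable e := MeasurableSpace.measurable_mapNatBool Y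
  have hei : Function.Injective e := MeasurableSpace.injective_mapNatBool Y
  set C : ℕ → Set Ω := fun m => {x | ∀ i < m, e (φ x) i = e (ψ x) i} with hC
  have hCm : ∀ m, MeasurableSet (C m) := fun m => by
    have : C m = ⋂ i, ⋂ (_ : i < m), {x | e (φ x) i = e (ψ x) i} := by ext x; simp [hC]
    rw [this]
    refine MeasurableSet.iInter fun i => MeasurableSet.iInter fun _ => ?_
    exact measurableSet_eq_fun ((measurable_pi_apply i).comp (hem.comp hφ))
      ((measurable_pi_apply i).comp (hem.comp hψ))
  have hCanti : Antitone C := fun m n hmn x hx i hi => hx i (hi.trans_le hmn)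
  have hC0 : ν (⋂ m, C m) = 0 := by
    refine measure_mono_null ?_ hne
    intro x hx hcon
    exact hcon (hei (funext fun i => Set.mem_iInter.1 hx (i + 1) i (Nat.lt_succ_self i)))
  have hlim := tendsto_measure_iInter_atTop (μ := ν)
    (fun m => (hCm m).nullMeasurableSet) hCanti ⟨0, measure_ne_top _ _⟩
  rw [hC0] at hlim
  have hKpos : (0 : ℝ≥0∞) < 1 / (K + 1) := by
    rw [one_div]; exact ENNReal.inv_pos.2 (by finiteness)
  obtain ⟨m, hm⟩ := (hlim.eventually_lt_const hKpos).exists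
  set ξ : Y → Fin m → Bool := fun y i => e y i with hξ
  have hξm : Measurable ξ :=
    measurable_pi_lambda _ fun i => (measurable_pi_apply (i : ℕ)).comp hem
  set D : ((Fin m → Bool) → Fin (K + 1)) → Set Ω := fun f =>
    {x | ξ (φ x) ≠ ξ (ψ x) ∧ f (ξ (φ x)) = f (ξ (ψ x))} with hD
  have hDm : ∀ f, MeasurableSet (D f) := fun f =>
    ((hξm.comp hφ).prodMk (hξm.comp hψ))
      (show MeasurableSet {z : (Fin m → Bool) × (Fin m → Bool) | z.1 ≠ z.2 ∧ f z.1 = f z.2} from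
        (Set.toFinite _).measurableSet)
  have hsum : ∑ f, ν (D f) ≤ ∑ _f : (Fin m → Bool) → Fin (K + 1), 1 / ((K : ℝ≥0∞) + 1) := by
    have h1 : ∑ f, ν (D f) = ∫⁻ x, ∑ f, (D f).indicator 1 x ∂ν := by
      rw [lintegral_finsetSum _ fun f _ => measurable_one.indicator (hDm f)]
      exact Finset.sum_congr rfl fun f _ => (lintegral_indicator_one (hDm f)).symm
    rw [h1]
    refine (lintegral_mono (g := fun _ => ∑ _f : (Fin m → Bool) → Fin (K + 1),
      1 / ((K : ℝ≥0∞) + 1)) fun x => ?_).trans (by simp)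
    by_cases hx : ξ (φ x) = ξ (ψ x)
    · simp [hD, hx, Set.indicator]
    · have := card_filter_apply_eq_mul_le K hx
      have hcast : ((Finset.univ.filter fun f : (Fin m → Bool) → Fin (K + 1) =>
          f (ξ (φ x)) = f (ξ (ψ x))).card : ℝ≥0∞) * (K + 1) ≤
          (Fintype.card ((Fin m → Bool) → Fin (K + 1)) : ℝ≥0∞) := by exact_mod_cast this
      simp only [hD, Set.indicator, Set.mem_ofPred_eq, ne_eq, hx, not_false_eq_true, true_and,
        Pi.one_apply, Finset.sum_boole, Finset.sum_const, nsmul_eq_mul, mul_one_div]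
      rw [ENNReal.le_div_iff_mul_le (by simp) (by simp)]
      simpa using hcast
  obtain ⟨f, hf⟩ : ∃ f, ν (D f) ≤ 1 / ((K : ℝ≥0∞) + 1) := by
    by_contra! hcon
    exact absurd (ENNReal.sum_lt_sum_of_nonempty Finset.univ_nonempty fun f _ => hcon f)
      hsum.not_gt
  refine ⟨fun y => f (ξ y), (measurable_of_finite f).comp hξm, ?_⟩
  have hsub : {x | f (ξ (φ x)) = f (ξ (ψ x))} ⊆ C m ∪ D f := by
    intro x hx
    by_cases h : ξ (φ x) = ξ (ψ x)
    · exact Or.inl fun i hi => congrFun h ⟨i, hi⟩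
    · exact Or.inr ⟨h, hx⟩
  calc ν {x | f (ξ (φ x)) = f (ξ (ψ x))} ≤ ν (C m) + ν (D f) :=
        (measure_mono hsub).trans (measure_union_le _ _)
    _ ≤ 1 / (K + 1) + 1 / (K + 1) := add_le_add hm.le hf
    _ = 2 / (K + 1) := by rw [← ENNReal.add_div]; norm_num

/-! ### Codes with prescribed lengths, and a cheap free factor -/

theorem measurable_shiftAct_comp {G L : Type*} [Group G] [Countable G] [MeasurableSpace L]
    {c : (G → L) → G} (hc : ∀ g, MeasurableSet {x | c x = g})
    {φ : (G → L) → (G → L)} (hφ : Measurable φ) :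
    Measurable fun x => shiftAct (c x) (φ x) := by
  intro t ht
  have : (fun x => shiftAct (c x) (φ x)) ⁻¹' t =
      ⋃ g : G, {x | c x = g} ∩ φ ⁻¹' (shiftAct g ⁻¹' t) := by
    ext x; simp
  rw [this]
  exact MeasurableSet.iUnion fun g => (hc g).inter (hφ (measurable_shiftAct g ht))

/-- An injective nonnegative measurable function on a standard Borel space. -/
theorem exists_measurable_injective_nonneg (Y : Type*) [MeasurableSpace Y]
    [StandardBorelSpace Y] :
    ∃ f : Y → ℝ, Measurable f ∧ Function.Injective f ∧ ∀ y, 0 ≤ f y :=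
  ⟨fun y => Real.exp (embeddingReal Y y),
    Real.measurable_exp.comp (measurableEmbedding_embeddingReal Y).measurable,
    Real.exp_injective.comp (measurableEmbedding_embeddingReal Y).injective,
    fun _ => (Real.exp_pos _).le⟩

/-- Kraft's inequality for the real code lengths `A`. -/
def Kraft {B : Type*} (A : B → ℝ) : Prop :=
  ∑' b, ENNReal.ofReal (Real.exp (-A b)) ≤ 1

theorem Kraft.nonneg {B : Type*} {A : B → ℝ} (h : Kraft A) (b : B) : 0 ≤ A b := by
  have h1 := (ENNReal.le_tsum b).trans h
  rw [ENNReal.ofReal_le_one, Real.exp_le_one_iff] at h1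
  linarith

theorem Kraft.comp_equiv {B C : Type*} {A : B → ℝ} (h : Kraft A) (E : C ≃ B) :
    Kraft (A ∘ E) := by
  unfold Kraft at h ⊢
  rwa [← E.tsum_eq] at h

theorem exists_kraft_geometric {η : ℝ} (hη : 0 < η) :
    ∃ a : ℕ → ℝ, a 0 = η ∧ Kraft a := by
  set c : ℝ := 1 - Real.exp (-η) with hc
  have hcpos : 0 < c := by
    have : Real.exp (-η) < 1 := Real.exp_lt_one_iff.2 (by linarith)
    linarith
  refine ⟨fun i => Nat.casesOn i η fun j => -Real.log (c / 2 / 2 ^ j), rfl, ?_⟩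
  unfold Kraft
  rw [tsum_eq_zero_add' ENNReal.summable]
  have h1 : ∀ j : ℕ, ENNReal.ofReal (Real.exp (-(-Real.log (c / 2 / 2 ^ j)))) =
      ENNReal.ofReal (c / 2 / 2 ^ j) := fun j => by
    rw [neg_neg, Real.exp_log (by positivity)]
  simp only [h1]
  rw [← ENNReal.ofReal_tsum_of_nonneg (fun j => by positivity) (summable_geometric_two' c),
    tsum_geometric_two', ← ENNReal.ofReal_add (Real.exp_pos _).le hcpos.le]
  simp [hc]

theorem exists_separating_code {G L : Type*} [Group G] [Countable G] [Infinite G]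
    [MeasurableSpace L] [StandardBorelSpace L] {κ : Measure (G → L)} [IsProbabilityMeasure κ]
    (hinv : ∀ g : G, MeasurePreserving (shiftAct g) κ κ)
    (hfree : ∀ g : G, g ≠ 1 → ∀ᵐ x ∂κ, shiftAct g x ≠ x) {η : ℝ} (hη : 0 < η) :
    ∃ (γ : (G → L) → ℕ) (A : ℕ → ℝ), Measurable γ ∧ Kraft A ∧
      ∫⁻ x, ENNReal.ofReal (A (γ x)) ∂κ ≤ ENNReal.ofReal η ∧
      ∀ g : G, g ≠ 1 → ∀ᵐ x ∂κ, ∃ h : G,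
        γ (shiftAct h x) ≠ γ (shiftAct h (shiftAct g x)) := by
  classical
  obtain ⟨f, hfm, hfi, hf0⟩ := exists_measurable_injective_nonneg (G → L)
  obtain ⟨e, he⟩ := exists_surjective_nat G
  set K : ℕ → ℕ := fun j => (Nat.unpair j).2 with hK
  set B := Σ i : ℕ, ((j : Fin i) → Fin (K j + 1)) with hBdef
  obtain ⟨a, ha0, haK⟩ := exists_kraft_geometric (half_pos hη)
  set len : ℕ → ℝ := fun i => a i + Real.log (Fintype.card ((j : Fin i) → Fin (K j + 1)))
    with hlen
  have hlenK : Kraft fun b : B => len b.1 := by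
    unfold Kraft
    rw [ENNReal.tsum_sigma']
    refine le_trans (le_of_eq (tsum_congr fun i => ?_)) haK
    rw [tsum_fintype]
    simp only
    rw [Finset.sum_const, Finset.card_univ, nsmul_eq_mul, hlen,
      ← ENNReal.ofReal_natCast, ← ENNReal.ofReal_mul (by positivity)]
    have hpos : (0 : ℝ) < Fintype.card ((j : Fin i) → Fin (K j + 1)) := by
      exact_mod_cast Fintype.card_pos
    congr 1
    rw [neg_add, Real.exp_add, Real.exp_neg (Real.log _), Real.exp_log hpos]
    field_simp
  -- the sizes of the marker sets
  obtain ⟨δ, hδpos, hδsum⟩ := ENNReal.exists_pos_sum_of_countable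
    (ε := ENNReal.ofReal (η / 2)) (by simpa using hη) ℕ
  have hθ : ∀ i, (δ i : ℝ≥0∞) / (ENNReal.ofReal (len (i + 1)) + 1) ≠ 0 := fun i => by
    refine ENNReal.div_ne_zero.2 ⟨by exact_mod_cast (hδpos i).ne', by finiteness⟩
  have hsep : ∀ g : G, g ≠ 1 → ∀ᵐ x ∂κ, f (shiftAct g x) ≠ f x := fun g hg => by
    filter_upwards [hfree g hg] with x hx using fun h => hx (hfi h)
  choose ε' hε'pos hε' using fun i => exists_measure_markerSet_lt hinv hfm hsep (hθ i)
  set ε : ℕ → ℝ := fun i => (Finset.range (i + 1)).inf' Finset.nonempty_range_add_one ε' with hε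
  have hεpos : ∀ i, 0 < ε i := fun i => (Finset.lt_inf'_iff _).2 fun j _ => hε'pos j
  have hεanti : Antitone ε := fun i j hij =>
    Finset.inf'_mono _ (Finset.range_mono (by omega)) _
  have hεle : ∀ i, ε i ≤ ε' i := fun i => Finset.inf'_le _ (by simp)
  set R : ℕ → Set (G → L) := fun i => markerSet f (ε i) with hR
  have hRm : ∀ i, MeasurableSet (R i) := fun i => measurableSet_markerSet hfm _
  have hRanti : Antitone R := fun i j hij => markerSet_mono f (hεanti hij)
  have hRlt : ∀ i, κ (R i) ≤ (δ i : ℝ≥0∞) / (ENNReal.ofReal (len (i + 1)) + 1) := fun i =>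
    (measure_mono (markerSet_mono f (hεle i))).trans (hε' i).le
  have hRδ : ∀ i, κ (R i) ≤ δ i := fun i =>
    (hRlt i).trans (ENNReal.div_le_of_le_mul (le_mul_of_one_le_right zero_le (by simp)))
  have hR0 : κ (⋂ i, R i) = 0 := by
    have hlim := ENNReal.tendsto_atTop_zero_of_tsum_ne_top (hδsum.trans_le le_top).ne
    refine le_antisymm (ge_of_tendsto' hlim fun i => ?_) zero_le
    exact (measure_mono (Set.iInter_subset _ i)).trans (hRδ i)
  have hout : ∀ᵐ x ∂κ, ∃ i, x ∉ R i := by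
    refine measure_mono_null (fun x hx => ?_) hR0
    have hx' : ¬ ∃ i, x ∉ R i := hx
    push Not at hx'
    exact Set.mem_iInter.2 hx'
  choose c hcm hcR hcdep using fun i => exists_measurable_return (hRm i)
    (exists_shiftAct_mem_markerSet (G := G) hf0 (hεpos i))
  -- the labels
  have hu : ∀ j, ∃ u : (G → L) → Fin (K j + 1), Measurable u ∧
      (e (Nat.unpair j).1 ≠ 1 → κ {x | u (shiftAct (c j x) x) =
        u (shiftAct (c j x) (shiftAct (e (Nat.unpair j).1) x))} ≤ 2 / (K j + 1)) := by
    intro j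
    by_cases hj : e (Nat.unpair j).1 = 1
    · exact ⟨fun _ => 0, measurable_const, fun h => absurd hj h⟩
    · have hne : ∀ᵐ x ∂κ, shiftAct (c j x) x ≠
          shiftAct (c j x) (shiftAct (e (Nat.unpair j).1) x) := by
        filter_upwards [hfree _ hj] with x hx using
          fun h => hx (shiftAct_injective _ h).symm
      obtain ⟨u, hum, hu⟩ := exists_finite_label_separating
        (measurable_shiftAct_comp (hcm j) measurable_id)
        (measurable_shiftAct_comp (hcm j) (measurable_shiftAct _)) hne (K j)
      exact ⟨u, hum, fun _ => hu⟩
  choose u hum hu using hu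
  set lev : (G → L) → ℕ := fun x => if h : ∃ i, x ∉ R i then Nat.find h else 0 with hlev
  have hlev_gt : ∀ x, (∃ i, x ∉ R i) → ∀ j, j < lev x ↔ x ∈ R j := by
    intro x hx j
    simp only [hlev, hx, dif_pos]
    constructor
    · intro h
      exact not_not.1 (Nat.find_min hx h)
    · intro h
      by_contra! hle
      exact Nat.find_spec hx (hRanti hle h)
  have hlev_iff : ∀ x i, lev x = i ↔
      (x ∉ R i ∧ ∀ j < i, x ∈ R j) ∨ (i = 0 ∧ ∀ j, x ∈ R j) := by
    intro x i
    by_cases hx : ∃ i, x ∉ R i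
    · simp only [hlev, hx, dif_pos]
      rw [Nat.find_eq_iff]
      constructor
      · exact fun h => Or.inl ⟨h.1, fun j hj => not_not.1 (h.2 j hj)⟩
      · rintro (h | ⟨-, h⟩)
        · exact ⟨h.1, fun j hj => not_not.2 (h.2 j hj)⟩
        · exact absurd hx (by push Not; exact h)
    · simp only [hlev, hx, dif_neg, not_false_eq_true]
      push Not at hx
      constructor
      · exact fun h => Or.inr ⟨h.symm, hx⟩
      · rintro (h | h)
        · exact absurd (hx i) h.1
        · exact h.1.symm
  have hlevm : ∀ i, MeasurableSet {x | lev x = i} := by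
    intro i
    simp only [hlev_iff]
    refine MeasurableSet.union (MeasurableSet.inter (hRm i).compl ?_)
      (MeasurableSet.inter (MeasurableSet.const _) ?_)
    · change MeasurableSet {x | ∀ j < i, x ∈ R j}
      have : {x | ∀ j < i, x ∈ R j} = ⋂ j, ⋂ (_ : j < i), R j := by ext; simp
      rw [this]
      exact MeasurableSet.iInter fun j => MeasurableSet.iInter fun _ => hRm j
    · change MeasurableSet {x | ∀ j, x ∈ R j}
      have : {x | ∀ j, x ∈ R j} = ⋂ j, R j := by ext; simp
      rw [this]
      exact MeasurableSet.iInter fun j => hRm j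
  set γ₀ : (G → L) → B := fun x => ⟨lev x, fun j => u j x⟩ with hγ₀
  have hBinf : Infinite B :=
    Infinite.of_injective (fun i : ℕ => (⟨i, fun _ => 0⟩ : B)) fun i j h => congrArg Sigma.fst h
  obtain ⟨hden⟩ := nonempty_denumerable B
  set E : B ≃ ℕ := Denumerable.eqv B with hE
  refine ⟨fun x => E (γ₀ x), fun n => len (E.symm n).1, ?_, hlenK.comp_equiv E.symm, ?_, ?_⟩
  · refine measurable_to_countable' fun n => ?_
    obtain ⟨⟨i, w⟩, rfl⟩ := E.surjective n
    have : (fun x => E (γ₀ x)) ⁻¹' {E ⟨i, w⟩} =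
        {x | lev x = i} ∩ ⋂ j : Fin i, u j ⁻¹' {w j} := by
      ext x
      simp only [Set.mem_preimage, Set.mem_singleton_iff, EmbeddingLike.apply_eq_iff_eq,
        Set.mem_inter_iff, Set.mem_iInter, hγ₀]
      constructor
      · intro h
        have h1 : lev x = i := congrArg Sigma.fst h
        subst h1
        exact ⟨rfl, fun j => congrFun (eq_of_heq (Sigma.mk.inj h).2) j⟩
      · rintro ⟨h1, h2⟩
        have h1' : lev x = i := h1
        subst h1'
        exact congrArg (Sigma.mk _) (funext h2)
    rw [this]
    exact (hlevm i).inter (MeasurableSet.iInter fun j => hum j (measurableSet_singleton _))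
  · simp only [Equiv.symm_apply_apply]
    have hlen0 : ENNReal.ofReal (len 0) = ENNReal.ofReal (η / 2) := by
      simp [hlen, ha0]
    have hpt : ∀ x, ENNReal.ofReal (len (lev x)) ≤ ENNReal.ofReal (η / 2) +
        ∑' i, (R i).indicator (fun _ => ENNReal.ofReal (len (i + 1))) x := by
      intro x
      rcases hcase : lev x with _ | i
      · rw [hlen0]; exact le_self_add
      · have hx : x ∈ R i := by
          rcases (hlev_iff x (i + 1)).1 hcase with h | h
          · exact h.2 i (Nat.lt_succ_self i)
          · exact absurd h.1 (Nat.succ_ne_zero i)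
        refine le_trans ?_ le_add_self
        refine le_trans ?_ (ENNReal.le_tsum i)
        simp [hx]
    refine (lintegral_mono hpt).trans ?_
    rw [lintegral_add_left measurable_const, lintegral_tsum]
    · simp only [lintegral_const, measure_univ, mul_one, lintegral_indicator_const (hRm _)]
      calc _ ≤ ENNReal.ofReal (η / 2) + ∑' i, (δ i : ℝ≥0∞) := by
            gcongr with i
            refine (mul_le_mul_right (hRlt i) _).trans ?_
            rw [← mul_div_assoc, mul_comm, mul_div_assoc]
            refine mul_le_of_le_one_right zero_le ?_
            exact ENNReal.div_le_of_le_mul (by simp)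
        _ ≤ ENNReal.ofReal (η / 2) + ENNReal.ofReal (η / 2) := by gcongr
        _ = ENNReal.ofReal η := by
            rw [← ENNReal.ofReal_add (by positivity) (by positivity)]; simp
    · exact fun i => (measurable_const.indicator (hRm i)).aemeasurable

  · intro g hg
    obtain ⟨k, rfl⟩ := he g
    have hae := ae_forall_shiftAct hinv hout
    have hbound : ∀ m : ℕ, κ {x | ¬ ∃ h : G, E (γ₀ (shiftAct h x)) ≠
        E (γ₀ (shiftAct h (shiftAct (e k) x)))} ≤ 2 / (m + 1) := by
      intro m
      have hj := hu (Nat.pair k m)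
      simp only [Nat.unpair_pair, hK] at hj
      refine le_trans (measure_mono_ae ?_) (hj hg)
      filter_upwards [hae] with x hx hcon
      have hcon' : ¬ ∃ h : G, E (γ₀ (shiftAct h x)) ≠
        E (γ₀ (shiftAct h (shiftAct (e k) x))) := hcon
      push Not at hcon'
      have hγeq : ∀ h : G, γ₀ (shiftAct h x) = γ₀ (shiftAct h (shiftAct (e k) x)) :=
        fun h => E.injective (hcon' h)
      have hleveq : ∀ h : G, lev (shiftAct h x) = lev (shiftAct h (shiftAct (e k) x)) :=
        fun h => congrArg Sigma.fst (hγeq h)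
      have hueq : ∀ (h : G) (j : ℕ), j < lev (shiftAct h x) →
          u j (shiftAct h x) = u j (shiftAct h (shiftAct (e k) x)) := by
        intro h j hlt
        have key : ∀ (b b' : B), b = b' → ∀ (hb : j < b.1) (hb' : j < b'.1),
            b.2 ⟨j, hb⟩ = b'.2 ⟨j, hb'⟩ := by
          rintro b _ rfl _ _; rfl
        exact key _ _ (hγeq h) hlt (lt_of_lt_of_eq hlt (hleveq h))
      have hx' : ∀ h : G, ∃ i, shiftAct h (shiftAct (e k) x) ∉ R i := fun h => by
        rw [← shiftAct_mul]; exact hx _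
      set j := Nat.pair k m
      have hvis : ∀ h : G, shiftAct h x ∈ R j ↔ shiftAct h (shiftAct (e k) x) ∈ R j :=
        fun h => by rw [← hlev_gt _ (hx h), ← hlev_gt _ (hx' h), hleveq h]
      exact hueq (c j x) j ((hlev_gt _ (hx _) j).2 (hcR j x))
    have hlim : Filter.Tendsto (fun m : ℕ => (2 : ℝ≥0∞) / (m + 1)) Filter.atTop (nhds 0) := by
      have h1 := (Filter.tendsto_add_atTop_iff_nat 1).2 ENNReal.tendsto_inv_nat_nhds_zero
      have h2 := ENNReal.Tendsto.const_mul (a := 2) h1 (Or.inr (by simp))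
      simpa [div_eq_mul_inv] using h2
    exact le_antisymm (ge_of_tendsto' hlim hbound) zero_le

/-! ### Conditional probabilities and Gibbs' inequality -/

theorem lintegral_restrict_eq_lintegral_mul {X : Type*} {m mX : MeasurableSpace X} (hm : m ≤ mX)
    {κ : Measure X} {S : Set X} {q : X → ℝ≥0∞} (hqm : Measurable[m] q)
    (hq : ∀ A, MeasurableSet[m] A → κ (A ∩ S) = ∫⁻ x in A, q x ∂κ)
    {f : X → ℝ≥0∞} (hf : Measurable[m] f) :
    ∫⁻ x in S, f x ∂κ = ∫⁻ x, q x * f x ∂κ := by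
  have htrim : (κ.restrict S).trim hm = (κ.trim hm).withDensity q := by
    refine @Measure.ext _ m _ _ fun A hA => ?_
    rw [trim_measurableSet_eq hm hA, Measure.restrict_apply (hm _ hA), hq A hA,
      withDensity_apply _ hA, restrict_trim hm κ hA, lintegral_trim hm hqm]
  rw [← lintegral_trim hm hf, htrim, lintegral_withDensity_eq_lintegral_mul _ hqm hf,
    lintegral_trim hm (hqm.mul hf)]
  rfl

theorem measure_inter_eq_setLIntegral_condExp {X : Type*} {m mX : MeasurableSpace X}
    (hm : m ≤ mX) {κ : Measure X} [IsFiniteMeasure κ] {S : Set X} (hS : MeasurableSet S)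
    {A : Set X} (hA : MeasurableSet[m] A) :
    κ (A ∩ S) = ∫⁻ x in A, ENNReal.ofReal ((κ[S.indicator (fun _ => (1 : ℝ))|m]) x) ∂κ := by
  have hSint : Integrable (S.indicator fun _ => (1 : ℝ)) κ := (integrable_const 1).indicator hS
  have hnn : 0 ≤ᵐ[κ] κ[S.indicator (fun _ => (1 : ℝ))|m] :=
    condExp_nonneg (Filter.Eventually.of_forall fun x =>
      Set.indicator_nonneg (fun _ _ => zero_le_one) x)
  rw [← ofReal_integral_eq_lintegral_ofReal integrable_condExp.integrableOn
    (ae_restrict_of_ae hnn), setIntegral_condExp hm hSint hA,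
    setIntegral_indicator hS]
  simp [Measure.real]

theorem condEnt_le_lintegral_of_kraft {X : Type*} {m mX : MeasurableSpace X} (hm : m ≤ mX)
    {κ : Measure X} [IsProbabilityMeasure κ] {β : X → ℕ} {A : ℕ → ℝ}
    (hA : Kraft A) (α : CtblPart X) (hα : ∀ i, α.piece i = {x | β x = i}) :
    condEnt m κ α ≤ ∫⁻ x, ENNReal.ofReal (A (β x)) ∂κ := by
  set P : ℕ → X → ℝ := fun i => κ[(α.piece i).indicator (fun _ => (1 : ℝ))|m] with hP
  set q : ℕ → X → ℝ≥0∞ := fun i x => ENNReal.ofReal (P i x) with hq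
  have hqm : ∀ i, Measurable[m] (q i) := fun i =>
    ENNReal.measurable_ofReal.comp stronglyMeasurable_condExp.measurable
  have hqA : ∀ i B, MeasurableSet[m] B → κ (B ∩ α.piece i) = ∫⁻ x in B, q i x ∂κ :=
    fun i B hB => measure_inter_eq_setLIntegral_condExp hm (α.measurable i) hB
  have hpos : ∀ᵐ x ∂κ, ∀ i, β x = i → 0 < P i x := by
    rw [ae_all_iff]
    intro i
    have hB : MeasurableSet[m] {x | q i x = 0} := hqm i (measurableSet_singleton 0)
    have h0 : κ ({x | q i x = 0} ∩ α.piece i) = 0 := by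
      rw [hqA i _ hB, setLIntegral_congr_fun (g := fun _ => 0) (hm _ hB) fun x hx => hx]
      simp
    refine measure_mono_null (fun x hx => ?_) h0
    have hx' : ¬ (β x = i → 0 < P i x) := hx
    push Not at hx'
    refine ⟨ENNReal.ofReal_eq_zero.2 hx'.2, ?_⟩
    rw [hα]; exact hx'.1
  have hle : ∀ᵐ x ∂κ, ∀ i, P i x ≤ 1 := by
    rw [ae_all_iff]
    intro i
    have h1 : κ[(α.piece i).indicator (fun _ => (1 : ℝ))|m] ≤ᵐ[κ] κ[fun _ => (1 : ℝ)|m] :=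
      condExp_mono ((integrable_const 1).indicator (α.measurable i)) (integrable_const 1)
        (Filter.Eventually.of_forall fun x => Set.indicator_le_self' (fun _ _ => zero_le_one) x)
    rw [condExp_const hm] at h1
    exact h1
  set r : X → ℝ≥0∞ := fun x => ∑' i, (α.piece i).indicator
    (fun x => ENNReal.ofReal (Real.exp (-A i)) * (q i x)⁻¹) x with hr
  have hrm : ∀ i, Measurable[m] fun x => ENNReal.ofReal (Real.exp (-A i)) * (q i x)⁻¹ :=
    fun i => (hqm i).inv.const_mul _
  have hrm' : Measurable r := Measurable.tsum fun i =>
    ((hrm i).mono hm le_rfl).indicator (α.measurable i)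
  have hrint : ∫⁻ x, r x ∂κ ≤ 1 := by
    rw [hr, lintegral_tsum fun i =>
      (((hrm i).mono hm le_rfl).indicator (α.measurable i)).aemeasurable]
    refine le_trans (ENNReal.tsum_le_tsum fun i => ?_) hA
    rw [lintegral_indicator (α.measurable i),
      lintegral_restrict_eq_lintegral_mul hm (hqm i) (hqA i) (hrm i)]
    calc _ ≤ ∫⁻ _, ENNReal.ofReal (Real.exp (-A i)) ∂κ := by
          refine lintegral_mono fun x => ?_
          simp only
          rw [mul_left_comm]
          exact mul_le_of_le_one_right zero_le (ENNReal.mul_inv_le_one _)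
      _ = _ := by simp
  have hmain : condEnt m κ α + 1 ≤ ∫⁻ x, ENNReal.ofReal (A (β x)) ∂κ + 1 := by
    calc condEnt m κ α + 1
        = ∫⁻ x, (ENNReal.ofReal (-Real.log (P (β x) x)) + 1) ∂κ := by
          rw [lintegral_add_right _ measurable_const]
          simp only [lintegral_const, measure_univ, mul_one, condEnt]
          congr 1
          refine lintegral_congr fun x => ?_
          congr 1
          rw [tsum_eq_single (β x)]
          · simp [hα, hP]
          · intro i hi
            simp [hα, hi.symm]
      _ ≤ ∫⁻ x, (ENNReal.ofReal (A (β x)) + r x) ∂κ := by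
          refine lintegral_mono_ae ?_
          filter_upwards [hpos, hle] with x hx hx1
          have h0 := hx _ rfl
          have hrx : r x = ENNReal.ofReal (Real.exp (-A (β x)) / P (β x) x) := by
            rw [hr]
            simp only
            rw [tsum_eq_single (β x)]
            · simp only [hα, Set.indicator, Set.mem_ofPred_eq, if_true, hq]
              rw [← ENNReal.ofReal_inv_of_pos h0, ← ENNReal.ofReal_mul (Real.exp_pos _).le,
                div_eq_mul_inv]
            · intro i hi
              simp [hα, hi.symm]
          rw [hrx, ← ENNReal.ofReal_one, ← ENNReal.ofReal_add
            (neg_nonneg.2 (Real.log_nonpos h0.le (hx1 _))) zero_le_one,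
            ← ENNReal.ofReal_add (hA.nonneg _) (by positivity)]
          refine ENNReal.ofReal_le_ofReal ?_
          have := Real.log_le_sub_one_of_pos (div_pos (Real.exp_pos (-A (β x))) h0)
          rw [Real.log_div (Real.exp_pos _).ne' h0.ne', Real.log_exp] at this
          linarith
      _ = ∫⁻ x, ENNReal.ofReal (A (β x)) ∂κ + ∫⁻ x, r x ∂κ := lintegral_add_right _ hrm'
      _ ≤ _ := by gcongr
  exact (ENNReal.add_le_add_iff_right ENNReal.one_ne_top).1 hmain

/-! ### Itineraries and pasts -/

/-- The itinerary of a labelling `γ` along the orbit of a point. -/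
def itin {G L : Type*} [Group G] (γ : (G → L) → ℕ) (x : G → L) : G → ℕ :=
  fun g => γ (shiftAct g x)

/-- The σ-algebra generated by all translates of the labelling `γ`. -/
abbrev itinAlg {G L : Type*} [Group G] (γ : (G → L) → ℕ) : MeasurableSpace (G → L) :=
  MeasurableSpace.comap (itin γ) inferInstance

/-- The itinerary of a point together with the letters it carries at the group elements which
come earlier in the order `o`. -/
def past {G L T : Type*} [Group G] [LT T] (γ : (G → L) → ℕ) (o : (G → L) → T) (x : G → L) :
    (G → ℕ) × (G → L → Prop) :=
  (itin γ x, fun h ℓ => o (shiftAct h x) < o x ∧ x h⁻¹ = ℓ)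

/-- The σ-algebra of the past: generated by the itinerary and the earlier letters. -/
abbrev pastAlg {G L T : Type*} [Group G] [LT T] (γ : (G → L) → ℕ) (o : (G → L) → T) :
    MeasurableSpace (G → L) :=
  MeasurableSpace.comap (past γ o) inferInstance

section Past

variable {G L T : Type*} [Group G] [LT T] {γ : (G → L) → ℕ} {o : (G → L) → T}

theorem itin_shiftAct (γ : (G → L) → ℕ) (g : G) (x : G → L) :
    itin γ (shiftAct g x) = fun h => itin γ x (h * g) := by
  funext h; simp [itin, shiftAct_mul]

theorem measurable_itin : Measurable[itinAlg γ] (itin γ) := comap_measurable _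

theorem measurable_shiftAct_itinAlg (g : G) :
    Measurable[itinAlg γ, itinAlg γ] (shiftAct g : (G → L) → G → L) := by
  rw [measurable_comap_iff]
  have : itin γ ∘ shiftAct g = fun x h => itin γ x (h * g) := by
    funext x; exact itin_shiftAct γ g x
  rw [this]
  exact @measurable_pi_lambda _ _ _ (itinAlg γ) _ _ fun h =>
    (measurable_pi_apply (h * g)).comp measurable_itin

theorem itinAlg_le_pastAlg : itinAlg γ ≤ pastAlg γ o := by
  rw [itinAlg, ← measurable_iff_comap_le]
  exact measurable_fst.comp (comap_measurable (past γ o))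

theorem measurableSet_pastAlg_letter (h : G) (ℓ : L) :
    MeasurableSet[pastAlg γ o] {x | o (shiftAct h x) < o x ∧ x h⁻¹ = ℓ} := by
  have h1 : Measurable[pastAlg γ o] (past γ o) := comap_measurable _
  have h2 := (measurable_pi_apply ℓ).comp ((measurable_pi_apply h).comp (measurable_snd.comp h1))
  exact (@measurableSet_setOfPred _ (pastAlg γ o) _).2 h2

theorem pastAlg_le {m : MeasurableSpace (G → L)} (h1 : itinAlg γ ≤ m)
    (h2 : ∀ h ℓ, MeasurableSet[m] {x | o (shiftAct h x) < o x ∧ x h⁻¹ = ℓ}) :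
    pastAlg γ o ≤ m := by
  rw [pastAlg, ← measurable_iff_comap_le]
  refine Measurable.prodMk (measurable_iff_comap_le.2 h1) ?_
  refine @measurable_pi_lambda _ _ _ m _ _ fun h => @measurable_pi_lambda _ _ _ m _ _ fun ℓ => ?_
  exact (@measurableSet_setOfPred _ m _).1 (h2 h ℓ)

/-- Functions measurable with respect to a comap σ-algebra factor through the map. -/
theorem eq_of_measurable_comap {X Y Z : Type*} {mY : MeasurableSpace Y} [MeasurableSpace Z]
    [MeasurableSingletonClass Z] {φ : X → Y} {f : X → Z}
    (hf : Measurable[MeasurableSpace.comap φ mY] f) {x y : X} (h : φ x = φ y) : f x = f y := by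
  obtain ⟨t, -, ht⟩ := hf (measurableSet_singleton (f x))
  have hx : x ∈ φ ⁻¹' t := by rw [ht]; rfl
  have hy : y ∈ φ ⁻¹' t := by
    change φ y ∈ t; rw [← h]; exact hx
  rw [ht] at hy
  exact (show f y = f x from hy).symm

end Past

theorem itinAlg_le {G L : Type*} [Group G] [Countable G] [mL : MeasurableSpace L]
    {γ : (G → L) → ℕ} (hγ : Measurable γ) :
    itinAlg γ ≤ (inferInstance : MeasurableSpace (G → L)) := by
  rw [itinAlg, ← measurable_iff_comap_le]
  exact measurable_pi_lambda _ fun g => hγ.comp (measurable_shiftAct g)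

section RealPast

variable {G L T : Type*} [Group G] {γ : (G → L) → ℕ}
  [LinearOrder T] [TopologicalSpace T] [OrderClosedTopology T] [SecondCountableTopology T]
  [MeasurableSpace T] [OpensMeasurableSpace T] {o : (G → L) → T}

theorem measurableSet_lt_itinAlg (ho : Measurable[itinAlg γ] o) (g h : G) :
    MeasurableSet[itinAlg γ] {x | o (shiftAct g x) < o (shiftAct h x)} :=
  @measurableSet_lt _ _ _ _ _ (itinAlg γ) _ _ _ _ _
    (ho.comp (measurable_shiftAct_itinAlg g)) (ho.comp (measurable_shiftAct_itinAlg h))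

theorem measurableSet_lt_itinAlg' (ho : Measurable[itinAlg γ] o) (g : G) :
    MeasurableSet[itinAlg γ] {x | o (shiftAct g x) < o x} := by
  simpa [shiftAct_one] using measurableSet_lt_itinAlg ho g 1

theorem pastAlg_le_borel [Countable G] [MeasurableSpace L] [MeasurableSingletonClass L]
    (hγ : Measurable γ) (ho : Measurable[itinAlg γ] o) :
    pastAlg γ o ≤ (inferInstance : MeasurableSpace (G → L)) := by
  refine pastAlg_le (itinAlg_le hγ) fun h ℓ => ?_
  exact MeasurableSet.inter (itinAlg_le hγ _ (measurableSet_lt_itinAlg' ho h))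
    (show MeasurableSet ((fun x : G → L => x h⁻¹) ⁻¹' {ℓ}) from
      measurable_pi_apply h⁻¹ (measurableSet_singleton ℓ))

theorem pastAlg_le_pastAlg {S : Type*} [LT S] {o' : (G → L) → S} (ho : Measurable[itinAlg γ] o)
    (h : ∀ (g : G) x, o (shiftAct g x) < o x → o' (shiftAct g x) < o' x) :
    pastAlg γ o ≤ pastAlg γ o' := by
  refine pastAlg_le itinAlg_le_pastAlg fun g ℓ => ?_
  have : {x | o (shiftAct g x) < o x ∧ x g⁻¹ = ℓ} = {x | o (shiftAct g x) < o x} ∩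
      {x | o' (shiftAct g x) < o' x ∧ x g⁻¹ = ℓ} := by
    ext x
    constructor
    · exact fun hx => ⟨hx.1, h g x hx.1, hx.2⟩
    · exact fun hx => ⟨hx.1, hx.2.2⟩
  rw [this]
  exact (itinAlg_le_pastAlg _ (measurableSet_lt_itinAlg' ho g)).inter
    (measurableSet_pastAlg_letter g ℓ)

/-- The past of an earlier point belongs to the past. -/
theorem measurableSet_pastAlg_shiftAct (ho : Measurable[itinAlg γ] o) (h : G)
    {S : Set (G → L)} (hS : MeasurableSet[pastAlg γ o] S) :
    MeasurableSet[pastAlg γ o] {x | o (shiftAct h x) < o x ∧ shiftAct h x ∈ S} := by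
  have hlt : MeasurableSet[pastAlg γ o] {x | o (shiftAct h x) < o x} :=
    itinAlg_le_pastAlg _ (measurableSet_lt_itinAlg' ho h)
  let m' : MeasurableSpace (G → L) :=
    { MeasurableSet' := fun S =>
        MeasurableSet[pastAlg γ o] {x | o (shiftAct h x) < o x ∧ shiftAct h x ∈ S}
      measurableSet_empty := by simp
      measurableSet_compl := fun S hS => by
        have : {x | o (shiftAct h x) < o x ∧ shiftAct h x ∈ Sᶜ} = {x | o (shiftAct h x) < o x} \
            {x | o (shiftAct h x) < o x ∧ shiftAct h x ∈ S} := by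
          ext x; simp; tauto
        rw [this]
        exact hlt.diff hS
      measurableSet_iUnion := fun f hf => by
        have : {x | o (shiftAct h x) < o x ∧ shiftAct h x ∈ ⋃ i, f i} =
            ⋃ i, {x | o (shiftAct h x) < o x ∧ shiftAct h x ∈ f i} := by
          ext x; simp
        rw [this]
        exact MeasurableSet.iUnion hf }
  have hle : pastAlg γ o ≤ m' := by
    refine pastAlg_le ?_ fun k ℓ => ?_
    · intro S hS
      exact hlt.inter (itinAlg_le_pastAlg _ (measurable_shiftAct_itinAlg h hS))
    · change MeasurableSet[pastAlg γ o] {x | o (shiftAct h x) < o x ∧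
        (o (shiftAct k (shiftAct h x)) < o (shiftAct h x) ∧ shiftAct h x k⁻¹ = ℓ)}
      have : {x | o (shiftAct h x) < o x ∧
          (o (shiftAct k (shiftAct h x)) < o (shiftAct h x) ∧ shiftAct h x k⁻¹ = ℓ)} =
          ({x | o (shiftAct h x) < o x} ∩ {x | o (shiftAct (k * h) x) < o (shiftAct h x)}) ∩
          {x | o (shiftAct (k * h) x) < o x ∧ x (k * h)⁻¹ = ℓ} := by
        ext x
        have e1 : shiftAct h x k⁻¹ = x (k * h)⁻¹ := by simp [shiftAct]
        simp only [Set.mem_ofPred_eq, Set.mem_inter_iff, shiftAct_mul, e1]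
        exact ⟨fun ⟨h1, h2, h3⟩ => ⟨⟨h1, h2⟩, h2.trans h1, h3⟩,
          fun ⟨⟨h1, h2⟩, _, h3⟩ => ⟨h1, h2, h3⟩⟩
      rw [this]
      exact (hlt.inter (itinAlg_le_pastAlg _ (measurableSet_lt_itinAlg ho _ _))).inter
        (measurableSet_pastAlg_letter _ _)
  exact hle _ hS

end RealPast

/-! ### Integer codes for weighted names -/

theorem exists_injective_code {W : Type*} [Fintype W] (ω : W → ℕ) :
    ∃ cd : W → ℕ, Function.Injective cd ∧ ∀ w, (cd w + 1) * ω w ≤ ∑ w', ω w' := by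
  classical
  let e : W ≃ Fin (Fintype.card W) := Fintype.equivFin W
  set f : W → ℕᵒᵈ ×ₗ Fin (Fintype.card W) := fun w => toLex (OrderDual.toDual (ω w), e w) with hf
  have hfi : Function.Injective f := fun w w' h => e.injective (congrArg Prod.snd h)
  have hfle : ∀ w w', f w ≤ f w' → ω w' ≤ ω w := by
    intro w w' h
    have h1 := Prod.Lex.monotone_fst _ _ h
    exact h1
  set B : W → Finset W := fun w => Finset.univ.filter fun w' => f w' < f w with hB
  refine ⟨fun w => (B w).card, ?_, ?_⟩
  · have key : ∀ w w', f w < f w' → (B w).card < (B w').card := by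
      intro w w' h
      refine Finset.card_lt_card ⟨fun u hu => ?_, fun hcon => ?_⟩
      · simp only [hB, Finset.mem_filter, Finset.mem_univ, true_and] at hu ⊢
        exact hu.trans h
      · have : w ∈ B w := hcon (by simp [hB, h])
        simp [hB] at this
    intro w w' h
    have h' : (B w).card = (B w').card := h
    rcases lt_trichotomy (f w) (f w') with h1 | h1 | h1
    · exact absurd h' (key _ _ h1).ne
    · exact hfi h1
    · exact absurd h' (key _ _ h1).ne'
  · intro w
    have hnot : w ∉ B w := by simp [hB]
    calc ((B w).card + 1) * ω w = ∑ _w' ∈ insert w (B w), ω w := by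
          rw [Finset.sum_const, Finset.card_insert_of_notMem hnot, smul_eq_mul]
      _ ≤ ∑ w' ∈ insert w (B w), ω w' := by
          refine Finset.sum_le_sum fun w' hw' => hfle _ _ ?_
          rcases Finset.mem_insert.1 hw' with rfl | h
          · exact le_rfl
          · exact (Finset.mem_filter.1 h).2.le
      _ ≤ ∑ w', ω w' := Finset.sum_le_sum_of_subset (Finset.subset_univ _)

/-- An integer code for the names `w : b → L`, favouring names of large product weight. -/
noncomputable def nameCode {G L : Type*} [Fintype L] (b : Finset G) (i : b → L → ℕ) :
    (b → L) → ℕ :=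
  open Classical in
  (exists_injective_code fun w : b → L => ∏ g, (i g (w g) + 1)).choose

theorem nameCode_injective {G L : Type*} [Fintype L] (b : Finset G) (i : b → L → ℕ) :
    Function.Injective (nameCode b i) := by
  classical
  exact (exists_injective_code fun w : b → L => ∏ g, (i g (w g) + 1)).choose_spec.1

theorem nameCode_mul_le {G L : Type*} [Fintype L] (b : Finset G) (i : b → L → ℕ) {T : ℕ}
    (hT : ∀ g, ∑ ℓ, (i g ℓ + 1) ≤ T) (w : b → L) :
    (nameCode b i w + 1) * ∏ g, (i g (w g) + 1) ≤ T ^ b.card := by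
  classical
  refine ((exists_injective_code fun w : b → L =>
    ∏ g, (i g (w g) + 1)).choose_spec.2 w).trans ?_
  rw [← Fintype.piFinset_univ,
    ← Finset.prod_univ_sum (t := fun _ => Finset.univ) (f := fun g ℓ => i g ℓ + 1)]
  calc _ ≤ ∏ _g : b, T := Finset.prod_le_prod' fun g _ => hT g
    _ = T ^ b.card := by simp

theorem ofReal_log_nameCode_le {G L : Type*} [Fintype L] (b : Finset G) (i : b → L → ℕ) {T : ℕ}
    (hT : ∀ g, ∑ ℓ, (i g ℓ + 1) ≤ T) (w : b → L) :
    ENNReal.ofReal (Real.log (nameCode b i w + 1)) ≤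
      ∑ g, ENNReal.ofReal (Real.log (T / (i g (w g) + 1))) := by
  have hle : ∀ g, ((i g (w g) : ℝ) + 1) ≤ T := fun g => by
    have h := (Finset.single_le_sum (f := fun ℓ => i g ℓ + 1) (fun _ _ => Nat.zero_le _)
      (Finset.mem_univ (w g))).trans (hT g)
    exact_mod_cast h
  have hnn : ∀ g, 0 ≤ Real.log (T / (i g (w g) + 1)) := fun g =>
    Real.log_nonneg ((one_le_div (by positivity)).2 (hle g))
  rw [← ENNReal.ofReal_sum_of_nonneg fun g _ => hnn g]
  refine ENNReal.ofReal_le_ofReal ?_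
  have hpos : ∀ g, (0 : ℝ) < T / (i g (w g) + 1) := fun g =>
    div_pos (lt_of_lt_of_le (by positivity) (hle g)) (by positivity)
  rw [← Real.log_prod fun g _ => (hpos g).ne']
  refine Real.log_le_log (by positivity) ?_
  rw [Finset.prod_div_distrib, le_div_iff₀ (Finset.prod_pos fun g _ => by positivity)]
  have := nameCode_mul_le b i hT w
  simp only [Finset.prod_const, Finset.card_univ, Fintype.card_coe]
  exact_mod_cast this

/-! ### Product code lengths -/

theorem Kraft.prod {B C : Type*} {A : B → ℝ} {D : C → ℝ} (hA : Kraft A) (hD : Kraft D) :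
    Kraft fun z : B × C => A z.1 + D z.2 := by
  unfold Kraft at *
  have h : ∀ z : B × C, ENNReal.ofReal (Real.exp (-(A z.1 + D z.2))) =
      ENNReal.ofReal (Real.exp (-A z.1)) * ENNReal.ofReal (Real.exp (-D z.2)) := fun z => by
    rw [neg_add, Real.exp_add, ENNReal.ofReal_mul (Real.exp_pos _).le]
  simp only [h]
  rw [ENNReal.tsum_prod']
  simp only [ENNReal.tsum_mul_left, ENNReal.tsum_mul_right]
  exact mul_le_one' hA hD

theorem Kraft.pi {D : ℕ → ℝ} (hD : Kraft D) (N : ℕ) :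
    Kraft fun w : Fin N → ℕ => ∑ k, D (w k) := by
  induction N with
  | zero => unfold Kraft; simp
  | succ N ih =>
    have h := (hD.prod ih).comp_equiv (Fin.consEquiv fun _ : Fin (N + 1) => ℕ).symm
    convert h using 1
    funext w
    simp [Fin.sum_univ_succ, Fin.consEquiv, Fin.tail]

theorem exists_kraft_log {t ε : ℝ} (ht : 0 < t) (hε : 0 < ε) :
    ∃ (D : ℕ → ℝ) (M : ℝ), Kraft D ∧ 0 ≤ M ∧ D 0 = ε ∧
      ∀ j, D (j + 1) = M + (1 + t) * Real.log (((j + 1 : ℕ) : ℝ) + 1) := by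
  have hsum : Summable fun j : ℕ => ((j : ℝ) + 2) ^ (-(1 + t)) := by
    have h := (Real.summable_nat_rpow (p := -(1 + t))).2 (by linarith)
    have h2 := (summable_nat_add_iff 2).2 h
    simpa using h2
  have hnn : ∀ j : ℕ, 0 ≤ ((j : ℝ) + 2) ^ (-(1 + t)) := fun j => by positivity
  set S : ℝ := ∑' j : ℕ, ((j : ℝ) + 2) ^ (-(1 + t)) with hS
  have hS0 : 0 ≤ S := tsum_nonneg hnn
  have hc : 0 < 1 - Real.exp (-ε) := by
    have : Real.exp (-ε) < 1 := Real.exp_lt_one_iff.2 (by linarith)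
    linarith
  set M : ℝ := max 0 (Real.log ((S + 1) / (1 - Real.exp (-ε)))) with hM
  have hMS : Real.exp (-M) * S ≤ 1 - Real.exp (-ε) := by
    have h1 : Real.exp (-M) ≤ (1 - Real.exp (-ε)) / (S + 1) := by
      rw [show (1 - Real.exp (-ε)) / (S + 1) =
        Real.exp (-Real.log ((S + 1) / (1 - Real.exp (-ε)))) by
          rw [Real.exp_neg (Real.log _), Real.exp_log (by positivity), inv_div]]
      exact Real.exp_le_exp.2 (neg_le_neg (le_max_right _ _))
    calc Real.exp (-M) * S ≤ (1 - Real.exp (-ε)) / (S + 1) * S := by gcongr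
      _ ≤ 1 - Real.exp (-ε) := by
          rw [div_mul_eq_mul_div, div_le_iff₀ (by positivity)]
          nlinarith
  refine ⟨fun j => Nat.casesOn j ε fun j => M + (1 + t) * Real.log (((j + 1 : ℕ) : ℝ) + 1), M,
    ?_, le_max_left _ _, rfl, fun j => rfl⟩
  unfold Kraft
  rw [tsum_eq_zero_add' ENNReal.summable]
  have h1 : ∀ j : ℕ, ENNReal.ofReal (Real.exp (-(M + (1 + t) *
      Real.log (((j + 1 : ℕ) : ℝ) + 1)))) =
      ENNReal.ofReal (Real.exp (-M) * ((j : ℝ) + 2) ^ (-(1 + t))) := fun j => by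
    have h2 : (((j + 1 : ℕ) : ℝ) + 1) = (j : ℝ) + 2 := by push_cast; ring
    rw [h2, neg_add, Real.exp_add, Real.rpow_def_of_pos (by positivity)]
    congr 3
    ring
  simp only [h1]
  rw [← ENNReal.ofReal_tsum_of_nonneg (fun j => mul_nonneg (Real.exp_pos _).le (hnn j))
    (hsum.mul_left _), tsum_mul_left, ← ENNReal.ofReal_add (Real.exp_pos _).le (by positivity)]
  refine ENNReal.ofReal_le_one.2 ?_
  change Real.exp (-ε) + Real.exp (-M) * S ≤ 1
  linarith

/-! ### Coding earlier letters cell by cell -/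

theorem rokhlinShift_le_of_injOn {G L : Type*} [Group G] [Countable G] [MeasurableSpace L]
    [StandardBorelSpace L] {κ : Measure (G → L)} [IsProbabilityMeasure κ] {β : (G → L) → ℕ}
    (hβ : Measurable β) {A : ℕ → ℝ} (hA : Kraft A) {X₀ : Set (G → L)} (hX₀ : MeasurableSet X₀)
    (hnull : κ X₀ᶜ = 0) (hinj : Set.InjOn (itin β) X₀) :
    rokhlinShift G κ ≤ ∫⁻ x, ENNReal.ofReal (A (β x)) ∂κ := by
  let α : CtblPart (G → L) :=
    { piece := fun i => {x | β x = i}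
      measurable := fun i => hβ (measurableSet_singleton i)
      disj := fun i j hij => Set.disjoint_left.2 fun x hx hx' =>
        hij ((show β x = i from hx).symm.trans hx')
      cover := Set.eq_univ_of_forall fun x => Set.mem_iUnion.2 ⟨β x, rfl⟩ }
  have hitm : Measurable (itin β) :=
    measurable_pi_lambda _ fun g => hβ.comp (measurable_shiftAct g)
  have hitσ : Measurable[sigmaShift G (Set.range α.piece)] (itin β) := by
    refine @measurable_pi_lambda _ _ _ (sigmaShift G _) _ _ fun g => ?_
    refine @measurable_to_countable' _ _ (_) _ (sigmaShift G _) _ fun i => ?_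
    exact MeasurableSpace.measurableSet_generateFrom ⟨g, α.piece i, ⟨i, rfl⟩, rfl⟩
  have hspan : SpansModNull (sigmaShift G (Set.range α.piece) ⊔ shiftInvSigma G L) κ := by
    intro S hS
    refine ⟨itin β ⁻¹' (itin β '' (S ∩ X₀)), ?_, ?_⟩
    · have him : MeasurableSet (itin β '' (S ∩ X₀)) :=
        (hS.inter hX₀).image_of_measurable_injOn hitm (hinj.mono Set.inter_subset_right)
      exact (le_sup_left : sigmaShift G (Set.range α.piece) ≤ _) _ (hitσ him)
    · refine measure_mono_null ?_ hnull
      rintro x (⟨hxS, hx⟩ | ⟨⟨y, ⟨hyS, hy⟩, hxy⟩, hx⟩) hx0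
      · exact hx ⟨x, ⟨hxS, hx0⟩, rfl⟩
      · exact hx (hinj hy hx0 hxy ▸ hyS)
  have hle : shiftInvSigma G L ≤ (inferInstance : MeasurableSpace (G → L)) :=
    MeasurableSpace.generateFrom_le fun s hs => hs.1
  exact (iInf₂_le α hspan).trans (condEnt_le_lintegral_of_kraft hle hA α fun i => rfl)

section Cell

variable {G L : Type*} [Group G]

/-- The group elements of level `k` in the cell returning to `x`. -/
def cell (c : (G → L) → G) (v : (G → L) → ℕ) (k : ℕ) (x : G → L) : Set G :=
  {g | c (shiftAct g x) = g⁻¹ ∧ v (shiftAct g x) = k}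

theorem cell_eq_empty_of_notMem {c : (G → L) → G} {v : (G → L) → ℕ} {R : Set (G → L)}
    (hc : ∀ x, shiftAct (c x) x ∈ R) {k : ℕ}
    {x : G → L} (hx : x ∉ R) : cell c v k x = ∅ := by
  refine Set.eq_empty_of_forall_notMem fun g hg => hx ?_
  have := hc (shiftAct g x)
  rwa [hg.1, ← shiftAct_mul, inv_mul_cancel, shiftAct_one] at this

/-- The code of the letters at level `k` of the cell of `x`. -/
noncomputable def cellCode [Fintype L] (c : (G → L) → G) (v : (G → L) → ℕ)
    (idx : (G → L) → L → ℕ) (k : ℕ) (x : G → L) : ℕ :=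
  open Classical in
  if h : (cell c v k x).Finite then
    nameCode h.toFinset (fun g => idx (shiftAct (g : G) x)) fun g => x (g : G)⁻¹
  else 0

variable [Fintype L] {c : (G → L) → G} {v : (G → L) → ℕ} {idx : (G → L) → L → ℕ}

theorem cellCode_eq {k : ℕ} {x : G → L} {b : Finset G} (hb : cell c v k x = b) :
    cellCode c v idx k x =
      nameCode b (fun g => idx (shiftAct (g : G) x)) fun g => x (g : G)⁻¹ := by
  have hfin : (cell c v k x).Finite := hb ▸ b.finite_toSet
  have hb' : hfin.toFinset = b := by ext g; simp [hb]
  rw [cellCode, dif_pos hfin]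
  subst hb'
  rfl

theorem cellCode_of_infinite {k : ℕ} {x : G → L} (h : ¬ (cell c v k x).Finite) :
    cellCode c v idx k x = 0 := by
  rw [cellCode, dif_neg h]



theorem cellCode_of_notMem {R : Set (G → L)} (hc : ∀ x, shiftAct (c x) x ∈ R) {T : ℕ}
    (k : ℕ) {x : G → L} (hx : x ∉ R) : cellCode c v idx k x = 0 := by
  have hb : cell c v k x = ((∅ : Finset G) : Set G) := by
    rw [cell_eq_empty_of_notMem hc hx, Finset.coe_empty]
  rw [cellCode_eq hb]
  have := nameCode_mul_le (∅ : Finset G) (fun g => idx (shiftAct (g : G) x)) (T := T)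
    (fun g => absurd g.2 (Finset.notMem_empty _)) fun g => x (g : G)⁻¹
  simpa using this

theorem measurable_cellCode [Countable G] [MeasurableSpace L] [MeasurableSingletonClass L]
    (hc : ∀ g, MeasurableSet {x | c x = g}) (hv : Measurable v) (hidx : Measurable idx) (k : ℕ) :
    Measurable (cellCode c v idx k) := by
  classical
  have hmem : ∀ g, MeasurableSet {x | g ∈ cell c v k x} := fun g =>
    (measurable_shiftAct g (hc g⁻¹)).inter
      (measurable_shiftAct g (hv (measurableSet_singleton k)))
  have hcell : ∀ b : Finset G, MeasurableSet {x | cell c v k x = b} := fun b => by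
    have : {x | cell c v k x = b} = ⋂ g : G, {x | g ∈ cell c v k x ↔ g ∈ b} := by
      ext x; simp [Set.ext_iff]
    rw [this]
    refine MeasurableSet.iInter fun g => ?_
    by_cases hg : g ∈ b
    · simpa [hg] using hmem g
    · have heq : {x | g ∈ cell c v k x ↔ g ∈ b} = {x | g ∈ cell c v k x}ᶜ := by
        ext x; simp [hg]
      exact heq ▸ (hmem g).compl
  have hname : ∀ b : Finset G, Measurable fun x : G → L =>
      nameCode b (fun g => idx (shiftAct (g : G) x)) fun g => x (g : G)⁻¹ := fun b => by
    have h1 : Measurable fun x : G → L => ((fun g : b => idx (shiftAct (g : G) x),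
        fun g : b => x (g : G)⁻¹) : (b → L → ℕ) × (b → L)) :=
      Measurable.prodMk
        (measurable_pi_lambda _ fun g : b => hidx.comp (measurable_shiftAct (g : G)))
        (measurable_pi_lambda _ fun g : b => measurable_pi_apply (g : G)⁻¹)
    exact (Measurable.of_discrete (f := fun z : (b → L → ℕ) × (b → L) =>
      nameCode b z.1 z.2)).comp h1
  refine measurable_to_countable' fun m => ?_
  have : cellCode c v idx k ⁻¹' {m} = (⋃ b : Finset G, {x | cell c v k x = b} ∩
      {x | nameCode b (fun g => idx (shiftAct (g : G) x)) (fun g => x (g : G)⁻¹) = m}) ∪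
      ((⋃ b : Finset G, {x | cell c v k x = b})ᶜ ∩ {_x | (0 : ℕ) = m}) := by
    ext x
    by_cases hx : (cell c v k x).Finite
    · obtain ⟨b, hb⟩ := hx.exists_finset_coe
      have huniq : ∀ b' : Finset G, cell c v k x = b' ↔ b' = b := fun b' => by
        rw [← hb, Finset.coe_inj, eq_comm]
      simp [cellCode_eq hb.symm, huniq]
    · have hne : ∀ b' : Finset G, cell c v k x ≠ b' := fun b' h => hx (h ▸ b'.finite_toSet)
      simp [cellCode_of_infinite hx, hne]
  rw [this]
  refine MeasurableSet.union (MeasurableSet.iUnion fun b => (hcell b).inter ?_)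
    ((MeasurableSet.iUnion hcell).compl.inter (MeasurableSet.const _))
  exact hname b (measurableSet_singleton m)

theorem lintegral_log_cellCode_le [Countable G] [MeasurableSpace L] [MeasurableSingletonClass L]
    {κ : Measure (G → L)} (hinv : ∀ g : G, MeasurePreserving (shiftAct g) κ κ)
    (hc : ∀ g, MeasurableSet {x | c x = g}) (hv : Measurable v)
    {T : ℕ} (hT : ∀ x, ∑ ℓ, (idx x ℓ + 1) ≤ T)
    (hF : Measurable fun x => ENNReal.ofReal (Real.log (T / (idx x (x 1) + 1)))) (k : ℕ) :
    ∫⁻ x, ENNReal.ofReal (Real.log (cellCode c v idx k x + 1)) ∂κ ≤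
      ∫⁻ x, {y | v y = k}.indicator
        (fun x => ENNReal.ofReal (Real.log (T / (idx x (x 1) + 1)))) x ∂κ := by
  classical
  set F : (G → L) → ℝ≥0∞ := fun x => ENNReal.ofReal (Real.log (T / (idx x (x 1) + 1))) with hFdef
  have hFk : Measurable ({y | v y = k}.indicator F) :=
    hF.indicator (hv (measurableSet_singleton k))
  rw [← lintegral_tsum_return hinv hc hFk]
  refine lintegral_mono fun x => ?_
  by_cases hx : (cell c v k x).Finite
  · obtain ⟨b, hb⟩ := hx.exists_finset_coe
    simp only [cellCode_eq hb.symm]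
    refine (ofReal_log_nameCode_le b _ (fun g => hT _) _).trans ?_
    refine le_trans (le_of_eq ?_) (ENNReal.sum_le_tsum b)
    rw [← Finset.sum_coe_sort b]
    refine Finset.sum_congr rfl fun g _ => ?_
    have hg : (g : G) ∈ cell c v k x := hb ▸ g.2
    rw [Set.indicator_of_mem (show shiftAct (g : G) x ∈ {y | c y = (g : G)⁻¹} from hg.1),
      Set.indicator_of_mem (show shiftAct (g : G) x ∈ {y | v y = k} from hg.2)]
    simp [hFdef, shiftAct]
  · simp [cellCode_of_infinite hx]

/-- Points with the same itineraries of labels and cell codes coincide. -/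
theorem eq_of_cellCode_eq {γ : (G → L) → ℕ} {n : ℕ} (hvn : ∀ x, v x ≤ n)
    (hcΓ : ∀ x y, itin γ x = itin γ y → c x = c y)
    (hvΓ : ∀ x y, itin γ x = itin γ y → v x = v y)
    (hidxΓ : ∀ x y, past γ v x = past γ v y → idx x = idx y) {x y : G → L}
    (hfin : ∀ g k, (cell c v k (shiftAct g x)).Finite)
    (hγ : itin γ x = itin γ y)
    (hcode : ∀ g, ∀ k ≤ n, cellCode c v idx k (shiftAct g x) =
      cellCode c v idx k (shiftAct g y)) : x = y := by
  classical
  have hγg : ∀ g, itin γ (shiftAct g x) = itin γ (shiftAct g y) := fun g => by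
    rw [itin_shiftAct, itin_shiftAct, hγ]
  have hcg : ∀ g, c (shiftAct g x) = c (shiftAct g y) := fun g => hcΓ _ _ (hγg g)
  have hvg : ∀ g, v (shiftAct g x) = v (shiftAct g y) := fun g => hvΓ _ _ (hγg g)
  have main : ∀ k g, v (shiftAct g x) = k → x g⁻¹ = y g⁻¹ := by
    intro k
    induction k using Nat.strong_induction_on with
    | _ k ih =>
      intro g hg
      set h : G := c (shiftAct g x) with hh
      obtain ⟨b, hb⟩ := (hfin (h * g) k).exists_finset_coe
      have hb' : cell c v k (shiftAct (h * g) y) = b := by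
        rw [hb]
        ext g'
        simp only [cell, ← shiftAct_mul, hcg, hvg]
      have hcd := hcode (h * g) k (hg ▸ hvn _)
      rw [cellCode_eq hb.symm, cellCode_eq hb'] at hcd
      have hidx : (fun g' : b => idx (shiftAct (g' : G) (shiftAct (h * g) x))) =
          fun g' : b => idx (shiftAct (g' : G) (shiftAct (h * g) y)) := by
        funext g'
        have hg' : (g' : G) ∈ cell c v k (shiftAct (h * g) x) := hb ▸ g'.2
        have hlev : v (shiftAct ((g' : G) * (h * g)) x) = k := by
          rw [shiftAct_mul]; exact hg'.2
        rw [← shiftAct_mul, ← shiftAct_mul]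
        refine hidxΓ _ _ (Prod.ext (hγg _) ?_)
        funext f ℓ
        simp only [past, ← shiftAct_mul, hvg]
        refine propext (and_congr_right fun hlt => ?_)
        have e1 : ∀ z : G → L, shiftAct ((g' : G) * (h * g)) z f⁻¹ =
            z (f * ((g' : G) * (h * g)))⁻¹ := fun z => by simp [shiftAct, mul_assoc]
        rw [e1, e1, ih _ (by rw [← hlev, hvg ((g' : G) * (h * g))]; exact hlt) _ (hvg _)]
      rw [hidx] at hcd
      have hw := nameCode_injective _ _ hcd
      have hmem : h⁻¹ ∈ b := by
        have : h⁻¹ ∈ cell c v k (shiftAct (h * g) x) := by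
          simp only [cell, ← shiftAct_mul]
          simp [← hh, hg]
        rw [← hb] at this
        exact this
      have := congrFun hw ⟨h⁻¹, hmem⟩
      simpa [shiftAct, mul_assoc] using this
  funext t
  simpa using main _ t⁻¹ rfl

end Cell

set_option maxHeartbeats 1000000 in
/-- A labelling together with counts measurable with respect to the finitely layered past
bounds the Rokhlin entropy by the expected length of the resulting code. -/
theorem rokhlinShift_le_of_past_code {G L : Type*} [Group G] [Countable G] [Infinite G]
    [Fintype L] [MeasurableSpace L] [MeasurableSingletonClass L]
    {κ : Measure (G → L)} [IsProbabilityMeasure κ]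
    (hinv : ∀ g : G, MeasurePreserving (shiftAct g) κ κ)
    {γ : (G → L) → ℕ} (hγ : Measurable γ) {A : ℕ → ℝ} (hA : Kraft A)
    {o : (G → L) → ℝ} (ho : Measurable[itinAlg γ] o) (ho0 : ∀ x, 0 ≤ o x)
    (hsep : ∀ g : G, g ≠ 1 → ∀ᵐ x ∂κ, o (shiftAct g x) ≠ o x)
    {v : (G → L) → ℕ} {n : ℕ} (hv : Measurable[itinAlg γ] v) (hvn : ∀ x, v x ≤ n)
    {idx : (G → L) → L → ℕ} (hidx : Measurable[pastAlg γ v] idx) {T : ℕ}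
    (hT : ∀ x, ∑ ℓ, (idx x ℓ + 1) ≤ T) {ε : ℝ} (hε : 0 < ε) :
    rokhlinShift G κ ≤ ∫⁻ x, ENNReal.ofReal (A (γ x)) ∂κ + ENNReal.ofReal ε +
      ∫⁻ x, ENNReal.ofReal (Real.log (T / (idx x (x 1) + 1))) ∂κ := by
  classical
  have hbor : itinAlg γ ≤ (inferInstance : MeasurableSpace (G → L)) := itinAlg_le hγ
  have hvB : Measurable v := hv.mono hbor le_rfl
  have hidxB : Measurable idx := hidx.mono (pastAlg_le_borel hγ hv) le_rfl
  obtain ⟨x₀⟩ : Nonempty (G → L) := nonempty_of_isProbabilityMeasure κ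
  have hletter : ∀ x ℓ, ((idx x ℓ : ℝ) + 1) ≤ T := fun x ℓ => by
    have h := (Finset.single_le_sum (f := fun ℓ => idx x ℓ + 1) (fun _ _ => Nat.zero_le _)
      (Finset.mem_univ ℓ)).trans (hT x)
    exact_mod_cast h
  have hT1 : (1 : ℝ) ≤ T := by
    have := hletter x₀ (x₀ 1)
    have h0 : (0 : ℝ) ≤ idx x₀ (x₀ 1) := Nat.cast_nonneg _
    linarith
  set F : (G → L) → ℝ≥0∞ := fun x => ENNReal.ofReal (Real.log (T / (idx x (x 1) + 1))) with hF
  have hFm : Measurable F := by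
    have h1 : Measurable fun x : G → L => idx x (x 1) := by
      have h2 : Measurable fun z : (L → ℕ) × L => z.1 z.2 :=
        measurable_from_prod_countable_left fun ℓ => measurable_pi_apply ℓ
      exact h2.comp (hidxB.prodMk (measurable_pi_apply 1))
    have h3 : Measurable fun i : ℕ => ENNReal.ofReal (Real.log (T / ((i : ℝ) + 1))) :=
      Measurable.of_discrete
    exact h3.comp h1
  have hFle : ∀ x, F x ≤ ENNReal.ofReal (Real.log T) := fun x => by
    have h0 := hletter x (x 1)
    have h1 : (1 : ℝ) ≤ (idx x (x 1) : ℝ) + 1 := by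
      linarith [Nat.cast_nonneg (α := ℝ) (idx x (x 1))]
    refine ENNReal.ofReal_le_ofReal (Real.log_le_log (by positivity) ?_)
    exact div_le_self (by positivity) h1
  have hlogT : 0 ≤ Real.log T := Real.log_nonneg hT1
  set t : ℝ := ε / 3 / (Real.log T + 1) with ht
  have htpos : 0 < t := by positivity
  obtain ⟨D, M, hD, hM, hD0, hDs⟩ := exists_kraft_log htpos
    (show 0 < ε / 3 / (n + 1) by positivity)
  obtain ⟨ε', hε', hR⟩ := exists_measure_markerSet_lt hinv (ho.mono hbor le_rfl) hsep
    (θ := ENNReal.ofReal (ε / 3 / ((n + 1) * (M + 1)))) (by simp; positivity)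
  set R := markerSet o ε' with hRdef
  have hRm : MeasurableSet R := measurableSet_markerSet (ho.mono hbor le_rfl) ε'
  obtain ⟨c, hcm, hcR, hcdep⟩ := exists_measurable_return hRm
    (exists_shiftAct_mem_markerSet (G := G) ho0 hε')
  set j : (G → L) → Fin (n + 1) → ℕ := fun x k => cellCode c v idx k x with hj
  have hjm : Measurable j := measurable_pi_lambda _ fun k =>
    measurable_cellCode hcm hvB hidxB k
  obtain ⟨hden⟩ := nonempty_denumerable (ℕ × (Fin (n + 1) → ℕ))
  set E : ℕ × (Fin (n + 1) → ℕ) ≃ ℕ := Denumerable.eqv _ with hE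
  set β : (G → L) → ℕ := fun x => E (γ x, j x) with hβ
  have hβm : Measurable β :=
    (Measurable.of_discrete (f := fun z : ℕ × (Fin (n + 1) → ℕ) => E z)).comp (hγ.prodMk hjm)
  have hK : Kraft ((fun z : ℕ × (Fin (n + 1) → ℕ) => A z.1 + ∑ k, D (z.2 k)) ∘ E.symm) :=
    (hA.prod (hD.pi (n + 1))).comp_equiv E.symm
  -- generation
  have hfin : ∀ᵐ x ∂κ, ∀ g, {h : G | c (shiftAct h (shiftAct g x)) = h⁻¹}.Finite :=
    ae_forall_shiftAct hinv (ae_finite_return hinv hcm)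
  set N : Set (G → L) :=
    {x | ¬ ∀ g, {h : G | c (shiftAct h (shiftAct g x)) = h⁻¹}.Finite} with hN
  have hN0 : κ (toMeasurable κ N) = 0 := by rw [measure_toMeasurable]; exact hfin
  have hvis : ∀ x y, itin γ x = itin γ y → ∀ g, shiftAct g x ∈ R ↔ shiftAct g y ∈ R := by
    intro x y hxy g
    have hog : ∀ g, o (shiftAct g x) = o (shiftAct g y) := fun g =>
      eq_of_measurable_comap ho (by rw [itin_shiftAct, itin_shiftAct, hxy])
    simp only [hRdef, markerSet, Set.mem_ofPred_eq, ← shiftAct_mul, hog]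
  have hinj : Set.InjOn (itin β) (toMeasurable κ N)ᶜ := by
    intro x hx y hy hxy
    have hxfin := not_not.1 fun h => hx (subset_toMeasurable κ N h)
    have hz : ∀ g, (γ (shiftAct g x), j (shiftAct g x)) = (γ (shiftAct g y), j (shiftAct g y)) :=
      fun g => E.injective (congrFun hxy g)
    have hγxy : itin γ x = itin γ y := funext fun g => congrArg Prod.fst (hz g)
    refine eq_of_cellCode_eq hvn (fun x y h => hcdep x y (hvis x y h))
      (fun x y h => eq_of_measurable_comap hv h) (fun x y h => eq_of_measurable_comap hidx h)
      (fun g k => (hxfin g).subset fun h hh => hh.1) hγxy fun g k hk => ?_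
    exact congrFun (congrArg Prod.snd (hz g)) ⟨k, Nat.lt_succ_of_le hk⟩
  refine (rokhlinShift_le_of_injOn hβm hK (measurableSet_toMeasurable κ N).compl
    (by rwa [compl_compl]) hinj).trans ?_
  -- the cost
  have hDle : ∀ k x, ENNReal.ofReal (D (j x k)) ≤ ENNReal.ofReal (ε / 3 / (n + 1)) +
      R.indicator (fun _ => ENNReal.ofReal M) x +
      ENNReal.ofReal (1 + t) * ENNReal.ofReal (Real.log (j x k + 1)) := by
    intro k x
    rcases hjk : j x k with _ | i
    · rw [hD0, add_assoc]; exact le_self_add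
    · have hx : x ∈ R := by
        by_contra hx
        have := cellCode_of_notMem (v := v) (idx := idx) hcR (T := T) k hx
        exact Nat.succ_ne_zero i (hjk.symm.trans this)
      rw [hDs, Set.indicator_of_mem hx, ← ENNReal.ofReal_mul (by positivity),
        ENNReal.ofReal_add hM (mul_nonneg (by positivity)
          (Real.log_nonneg (by push_cast; linarith [Nat.cast_nonneg (α := ℝ) i])))]
      gcongr
      exact le_add_self
  have hFk : ∑ k : Fin (n + 1), ∫⁻ x, {y | v y = k}.indicator F x ∂κ = ∫⁻ x, F x ∂κ := by
    rw [← lintegral_finsetSum _ fun (k : Fin (n + 1)) _ =>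
      hFm.indicator (show MeasurableSet {y | v y = k} from
        hvB (measurableSet_singleton (k : ℕ)))]
    refine lintegral_congr fun x => ?_
    rw [Finset.sum_eq_single ⟨v x, Nat.lt_succ_of_le (hvn x)⟩]
    · simp
    · intro k _ hk
      refine Set.indicator_of_notMem (fun h => hk (Fin.ext ?_)) _
      exact (show v x = k from h).symm
    · simp
  have hterm : ∀ k : Fin (n + 1), ∫⁻ x, ENNReal.ofReal (D (j x k)) ∂κ ≤
      ENNReal.ofReal (ε / 3 / (n + 1)) + ENNReal.ofReal (ε / 3 / (n + 1)) +
      ENNReal.ofReal (1 + t) * ∫⁻ x, {y | v y = k}.indicator F x ∂κ := by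
    intro k
    refine (lintegral_mono (hDle k)).trans ?_
    have hm1 : Measurable fun x => ENNReal.ofReal (Real.log ((j x k : ℝ) + 1)) :=
      (Measurable.of_discrete (f := fun i : ℕ => ENNReal.ofReal (Real.log ((i : ℝ) + 1)))).comp
        ((measurable_pi_apply k).comp hjm)
    rw [lintegral_add_right _ (hm1.const_mul _), lintegral_add_left measurable_const,
      lintegral_const_mul _ hm1, lintegral_indicator_const hRm, lintegral_const, measure_univ,
      mul_one]
    refine add_le_add (add_le_add le_rfl ?_) (mul_le_mul_right ?_ _)
    · calc ENNReal.ofReal M * κ R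
          ≤ ENNReal.ofReal (M + 1) * ENNReal.ofReal (ε / 3 / ((n + 1) * (M + 1))) := by
            gcongr; linarith
        _ = ENNReal.ofReal (ε / 3 / (n + 1)) := by
            rw [← ENNReal.ofReal_mul (by positivity)]
            congr 1; field_simp
    · exact lintegral_log_cellCode_le hinv hcm hvB hT hFm k
  calc ∫⁻ x, ENNReal.ofReal (((fun z : ℕ × (Fin (n + 1) → ℕ) => A z.1 + ∑ k, D (z.2 k)) ∘
        E.symm) (β x)) ∂κ
      = ∫⁻ x, (ENNReal.ofReal (A (γ x)) + ∑ k, ENNReal.ofReal (D (j x k))) ∂κ := by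
        refine lintegral_congr fun x => ?_
        simp only [hβ, Function.comp, Equiv.symm_apply_apply]
        rw [ENNReal.ofReal_add (hA.nonneg _) (Finset.sum_nonneg fun k _ => hD.nonneg _),
          ENNReal.ofReal_sum_of_nonneg fun k _ => hD.nonneg _]
    _ = ∫⁻ x, ENNReal.ofReal (A (γ x)) ∂κ +
        ∑ k, ∫⁻ x, ENNReal.ofReal (D (j x k)) ∂κ := by
        rw [lintegral_add_left, lintegral_finsetSum]
        · exact fun k _ => (Measurable.of_discrete (f := fun i : ℕ => ENNReal.ofReal (D i))).comp
            ((measurable_pi_apply k).comp hjm)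
        · exact (Measurable.of_discrete (f := fun i : ℕ => ENNReal.ofReal (A i))).comp hγ
    _ ≤ ∫⁻ x, ENNReal.ofReal (A (γ x)) ∂κ + (ENNReal.ofReal (ε / 3) + ENNReal.ofReal (ε / 3) +
        ENNReal.ofReal (1 + t) * ∫⁻ x, F x ∂κ) := by
        gcongr
        refine (Finset.sum_le_sum fun k _ => hterm k).trans (le_of_eq ?_)
        rw [Finset.sum_add_distrib, ← Finset.mul_sum, hFk]
        congr 1
        rw [Finset.sum_const, Finset.card_univ, Fintype.card_fin, nsmul_eq_mul, mul_add,
          ← ENNReal.ofReal_natCast, ← ENNReal.ofReal_mul (by positivity)]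
        have : ((n + 1 : ℕ) : ℝ) * (ε / 3 / (n + 1)) = ε / 3 := by
          push_cast; field_simp
        rw [this]
    _ ≤ ∫⁻ x, ENNReal.ofReal (A (γ x)) ∂κ + (ENNReal.ofReal (ε / 3) + ENNReal.ofReal (ε / 3) +
        (∫⁻ x, F x ∂κ + ENNReal.ofReal (ε / 3))) := by
        gcongr
        rw [ENNReal.ofReal_add zero_le_one htpos.le, ENNReal.ofReal_one, add_mul, one_mul]
        gcongr
        calc ENNReal.ofReal t * ∫⁻ x, F x ∂κ
            ≤ ENNReal.ofReal t * ENNReal.ofReal (Real.log T) := by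
              gcongr
              exact (lintegral_mono hFle).trans (by simp)
          _ = ENNReal.ofReal (t * Real.log T) := (ENNReal.ofReal_mul htpos.le).symm
          _ ≤ ENNReal.ofReal (ε / 3) := by
              refine ENNReal.ofReal_le_ofReal ?_
              rw [ht, div_mul_eq_mul_div, div_le_iff₀ (by positivity)]
              nlinarith
    _ = _ := by
        have : ENNReal.ofReal ε =
            ENNReal.ofReal (ε / 3) + ENNReal.ofReal (ε / 3) + ENNReal.ofReal (ε / 3) := by
          rw [← ENNReal.ofReal_add (by positivity) (by positivity),
            ← ENNReal.ofReal_add (by positivity) (by positivity)]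
          congr 1; ring
        rw [this]; ring

/-! ### Conditional letter probabilities -/

theorem measurableSet_letter {X L : Type*} [MeasurableSpace X] [MeasurableSpace L]
    [MeasurableSingletonClass L] {a : X → L} (ha : Measurable a) (ℓ : L) :
    MeasurableSet {y | a y = ℓ} :=
  ha (measurableSet_singleton ℓ)

/-- The conditional probability, given `m`, that the letter `a` is `ℓ`. -/
noncomputable def letterProb {X L : Type*} (m : MeasurableSpace X) [mX : MeasurableSpace X]
    [StandardBorelSpace X] (κ : Measure X) [IsFiniteMeasure κ] (a : X → L) (ℓ : L) (x : X) : ℝ :=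
  (ProbabilityTheory.condExpKernel κ m x).real {y | a y = ℓ}

/-- The expected entropy of the letter `a` given `m`. -/
noncomputable def letterEnt {X L : Type*} [Fintype L] (m : MeasurableSpace X)
    [mX : MeasurableSpace X] [StandardBorelSpace X] (κ : Measure X) [IsFiniteMeasure κ]
    (a : X → L) : ℝ≥0∞ :=
  ∫⁻ x, ∑ ℓ, ENNReal.ofReal (Real.negMulLog (letterProb m κ a ℓ x)) ∂κ

section LetterProb

variable {X L : Type*} {m : MeasurableSpace X} [mX : MeasurableSpace X] [StandardBorelSpace X]
  {κ : Measure X} [IsProbabilityMeasure κ] {a : X → L}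

theorem letterProb_nonneg (ℓ : L) (x : X) : 0 ≤ letterProb m κ a ℓ x := measureReal_nonneg

theorem letterProb_le_one (ℓ : L) (x : X) : letterProb m κ a ℓ x ≤ 1 :=
  measureReal_le_one

variable [MeasurableSpace L] [MeasurableSingletonClass L]

theorem measurable_letterProb (ha : Measurable a) (ℓ : L) :
    Measurable[m] (letterProb m κ a ℓ) :=
  (ProbabilityTheory.measurable_condExpKernel (measurableSet_letter ha ℓ)).ennreal_toReal

theorem sum_letterProb [Fintype L] (ha : Measurable a) (x : X) : ∑ ℓ, letterProb m κ a ℓ x = 1 := by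
  classical
  unfold letterProb
  rw [← measureReal_biUnion_finset]
  · have : (⋃ ℓ ∈ (Finset.univ : Finset L), {y : X | a y = ℓ}) = Set.univ := by
      ext y; simp
    rw [this]
    simp
  · intro i _ j _ hij
    refine Set.disjoint_left.2 fun y hy hy' => hij ?_
    exact (show a y = i from hy).symm.trans hy'
  · exact fun ℓ _ => measurableSet_letter ha ℓ

theorem letterProb_ae_eq (hm : m ≤ mX) (ha : Measurable a) (ℓ : L) :
    letterProb m κ a ℓ =ᵐ[κ] κ[{y | a y = ℓ}.indicator (fun _ => (1 : ℝ))|m] :=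
  ProbabilityTheory.condExpKernel_ae_eq_condExp hm (measurableSet_letter ha ℓ)

theorem measure_inter_letter (hm : m ≤ mX) (ha : Measurable a) (ℓ : L)
    {A : Set X} (hA : MeasurableSet[m] A) :
    κ (A ∩ {y | a y = ℓ}) = ∫⁻ x in A, ENNReal.ofReal (letterProb m κ a ℓ x) ∂κ := by
  rw [measure_inter_eq_setLIntegral_condExp hm (measurableSet_letter ha ℓ) hA]
  refine lintegral_congr_ae (ae_restrict_of_ae ?_)
  filter_upwards [letterProb_ae_eq (κ := κ) hm ha ℓ] with x hx
  rw [hx]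

theorem setLIntegral_letter (hm : m ≤ mX) (ha : Measurable a) (ℓ : L)
    {f : X → ℝ≥0∞} (hf : Measurable[m] f) :
    ∫⁻ x in {y | a y = ℓ}, f x ∂κ =
      ∫⁻ x, ENNReal.ofReal (letterProb m κ a ℓ x) * f x ∂κ :=
  lintegral_restrict_eq_lintegral_mul hm
    (q := fun x => ENNReal.ofReal (letterProb m κ a ℓ x))
    (ENNReal.measurable_ofReal.comp (measurable_letterProb ha ℓ))
    (fun _ hA => measure_inter_letter hm ha ℓ hA) hf

theorem lintegral_letter [Fintype L] (hm : m ≤ mX) (ha : Measurable a)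
    {f : L → X → ℝ≥0∞} (hf : ∀ ℓ, Measurable[m] (f ℓ)) :
    ∫⁻ x, f (a x) x ∂κ =
      ∫⁻ x, ∑ ℓ, ENNReal.ofReal (letterProb m κ a ℓ x) * f ℓ x ∂κ := by
  classical
  have h1 : ∀ x, f (a x) x = ∑ ℓ, {y : X | a y = ℓ}.indicator (f ℓ) x := by
    intro x
    rw [Finset.sum_eq_single (a x)]
    · simp
    · intro ℓ _ hℓ
      rw [Set.indicator_of_notMem]
      exact fun h => hℓ (show a x = ℓ from h).symm
    · simp
  simp_rw [h1]
  rw [lintegral_finsetSum _ fun ℓ _ =>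
    ((hf ℓ).mono hm le_rfl).indicator (measurableSet_letter ha ℓ), lintegral_finsetSum]
  · refine Finset.sum_congr rfl fun ℓ _ => ?_
    rw [lintegral_indicator (measurableSet_letter ha ℓ), setLIntegral_letter hm ha ℓ (hf ℓ)]
  · intro ℓ _
    have h2 : Measurable[m] fun x => ENNReal.ofReal (letterProb m κ a ℓ x) * f ℓ x :=
      (ENNReal.measurable_ofReal.comp (measurable_letterProb ha ℓ)).mul (hf ℓ)
    exact h2.mono hm le_rfl

end LetterProb

/-! ### Approximating the order by finitely many layers -/

open Classical in
/-- The number of the first `n` thresholds of `s` that are at most `t`. -/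
noncomputable def level (s : ℕ → ℝ) (n : ℕ) (t : ℝ) : ℕ :=
  ((Finset.range n).filter fun i => s i ≤ t).card

theorem level_le (s : ℕ → ℝ) (n : ℕ) (t : ℝ) : level s n t ≤ n := by
  classical
  exact (Finset.card_filter_le _ _).trans (by simp)

theorem level_mono (s : ℕ → ℝ) (n : ℕ) : Monotone (level s n) := by
  classical
  intro a b hab
  refine Finset.card_le_card fun i hi => ?_
  rw [Finset.mem_filter] at hi ⊢
  exact ⟨hi.1, hi.2.trans hab⟩

theorem level_lt_level_iff {s : ℕ → ℝ} {n : ℕ} {a b : ℝ} :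
    level s n a < level s n b ↔ ∃ i < n, a < s i ∧ s i ≤ b := by
  classical
  constructor
  · intro h
    by_contra! hc
    refine absurd h (not_lt.2 (Finset.card_le_card fun i hi => ?_))
    rw [Finset.mem_filter, Finset.mem_range] at hi ⊢
    refine ⟨hi.1, ?_⟩
    by_contra hlt
    exact absurd hi.2 (not_le.2 (hc i hi.1 (not_le.1 hlt)))
  · rintro ⟨i, hi, h1, h2⟩
    refine Finset.card_lt_card ⟨fun j hj => ?_, fun hsub => ?_⟩
    · simp only [Finset.mem_filter] at hj ⊢
      exact ⟨hj.1, hj.2.trans (h1.le.trans h2)⟩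
    · have := hsub (Finset.mem_filter.2 ⟨Finset.mem_range.2 hi, h2⟩)
      exact absurd (Finset.mem_filter.1 this).2 (not_le.2 h1)

/-- The filtration of the pasts with respect to finer and finer layers. -/
noncomputable def levelFiltration {G L : Type*} [Group G] [Countable G] [MeasurableSpace L]
    [MeasurableSingletonClass L] {γ : (G → L) → ℕ} (hγ : Measurable γ) {o : (G → L) → ℝ}
    (ho : Measurable[itinAlg γ] o) (s : ℕ → ℝ) :
    Filtration ℕ (inferInstance : MeasurableSpace (G → L)) where
  seq n := pastAlg γ fun x => level s n (o x)
  mono' := by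
    intro i j hij
    refine pastAlg_le_pastAlg ((level_mono s i).measurable.comp ho) fun g x h => ?_
    obtain ⟨k, hk, h1⟩ := level_lt_level_iff.1 h
    exact level_lt_level_iff.2 ⟨k, hk.trans_le hij, h1⟩
  le' n := pastAlg_le_borel hγ ((level_mono s n).measurable.comp ho)

theorem iSup_levelFiltration {G L : Type*} [Group G] [Countable G] [MeasurableSpace L]
    [MeasurableSingletonClass L] {γ : (G → L) → ℕ} (hγ : Measurable γ) {o : (G → L) → ℝ}
    (ho : Measurable[itinAlg γ] o) {s : ℕ → ℝ} (hs : DenseRange s) :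
    ⨆ n, levelFiltration hγ ho s n = pastAlg γ o := by
  refine le_antisymm (iSup_le fun n => ?_) (pastAlg_le ?_ fun h ℓ => ?_)
  · refine pastAlg_le_pastAlg ((level_mono s n).measurable.comp ho) fun g x h => ?_
    by_contra hle
    exact absurd h (not_lt.2 (level_mono s n (not_lt.1 hle)))
  · exact itinAlg_le_pastAlg.trans (le_iSup (fun n => levelFiltration hγ ho s n) 0)
  · have : {x | o (shiftAct h x) < o x ∧ x h⁻¹ = ℓ} =
        ⋃ n, {x | level s n (o (shiftAct h x)) < level s n (o x) ∧ x h⁻¹ = ℓ} := by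
      ext x
      simp only [Set.mem_ofPred_eq, Set.mem_iUnion, exists_and_right]
      refine and_congr_left fun _ => ⟨fun hlt => ?_, fun ⟨n, hn⟩ => ?_⟩
      · obtain ⟨i, hi⟩ := hs.exists_mem_open isOpen_Ioo (Set.nonempty_Ioo.2 hlt)
        exact ⟨i + 1, level_lt_level_iff.2 ⟨i, i.lt_succ_self, hi.1, hi.2.le⟩⟩
      · by_contra hle
        exact absurd hn (not_lt.2 (level_mono s n (not_lt.1 hle)))
    rw [this]
    refine MeasurableSet.iUnion fun n => ?_
    exact le_iSup (fun n => levelFiltration hγ ho s n) n _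
      (measurableSet_pastAlg_letter (o := fun x => level s n (o x)) h ℓ)

theorem ofReal_mul_log_le {q M T : ℝ} (hq0 : 0 ≤ q) (hq1 : q ≤ 1) (hM : 1 ≤ M) (hMT : M ≤ T) :
    ENNReal.ofReal q * ENNReal.ofReal (Real.log (T / max 1 (M * q))) ≤
      ENNReal.ofReal q * ENNReal.ofReal (Real.log (T / M)) +
        ENNReal.ofReal (Real.negMulLog q) := by
  rcases hq0.eq_or_lt with rfl | hq
  · simp
  have hT : 0 < T := by linarith
  have hM0 : 0 < M := by linarith
  have h1 : Real.log (T / max 1 (M * q)) ≤ Real.log (T / M) - Real.log q := by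
    rw [← Real.log_div (by positivity) hq.ne', div_div]
    refine Real.log_le_log (by positivity) ?_
    gcongr
    exact le_max_right _ _
  rw [← ENNReal.ofReal_mul hq0, ← ENNReal.ofReal_mul hq0, ← ENNReal.ofReal_add
    (mul_nonneg hq0 (Real.log_nonneg ((one_le_div hM0).2 hMT))) (Real.negMulLog_nonneg hq0 hq1)]
  refine ENNReal.ofReal_le_ofReal ?_
  rw [Real.negMulLog]
  nlinarith

section Limit

variable {G L : Type*} [Group G] [Countable G] [Infinite G]
  [Fintype L] [MeasurableSpace L] [MeasurableSingletonClass L] [StandardBorelSpace L]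
  {κ : Measure (G → L)} [IsProbabilityMeasure κ]
  {γ : (G → L) → ℕ} {A : ℕ → ℝ} {o : (G → L) → ℝ}

theorem rokhlinShift_le_lintegral_log
    (hinv : ∀ g : G, MeasurePreserving (shiftAct g) κ κ) (hγ : Measurable γ) (hA : Kraft A)
    (ho : Measurable[itinAlg γ] o) (ho0 : ∀ x, 0 ≤ o x)
    (hsep : ∀ g : G, g ≠ 1 → ∀ᵐ x ∂κ, o (shiftAct g x) ≠ o x) {ε : ℝ} (hε : 0 < ε)
    (s : ℕ → ℝ) (n M : ℕ) (hM : 1 ≤ M) :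
    rokhlinShift G κ ≤ ∫⁻ x, ENNReal.ofReal (A (γ x)) ∂κ + ENNReal.ofReal ε +
      ∫⁻ x, ENNReal.ofReal (Real.log ((M + Fintype.card L : ℝ) /
        max 1 (M * letterProb (levelFiltration hγ ho s n) κ (fun x => x 1) (x 1) x))) ∂κ := by
  have ha : Measurable fun x : G → L => x 1 := measurable_pi_apply 1
  set q := letterProb (levelFiltration hγ ho s n) κ fun x : G → L => x 1 with hq
  have hidx : Measurable[pastAlg γ fun x => level s n (o x)] fun x ℓ => ⌊M * q ℓ x⌋₊ := by
    refine @measurable_pi_lambda _ _ _ (pastAlg γ fun x => level s n (o x)) _ _ fun ℓ => ?_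
    exact Nat.measurable_floor.comp ((measurable_letterProb ha ℓ).const_mul _)
  refine (rokhlinShift_le_of_past_code hinv hγ hA ho ho0 hsep
    ((level_mono s n).measurable.comp ho) (fun x => level_le s n (o x)) hidx
    (T := M + Fintype.card L) (fun x => ?_) hε).trans ?_
  · rw [Finset.sum_add_distrib]
    simp only [Finset.sum_const, Finset.card_univ, smul_eq_mul, mul_one, add_le_add_iff_right]
    have h1 : ((∑ ℓ, ⌊M * q ℓ x⌋₊ : ℕ) : ℝ) ≤ M := by
      push_cast
      calc ∑ ℓ, (⌊M * q ℓ x⌋₊ : ℝ) ≤ ∑ ℓ, M * q ℓ x := Finset.sum_le_sum fun ℓ _ =>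
            Nat.floor_le (mul_nonneg (Nat.cast_nonneg _) (letterProb_nonneg ℓ x))
        _ = M := by rw [← Finset.mul_sum, sum_letterProb ha, mul_one]
    exact_mod_cast h1
  · have hM0 : (0 : ℝ) < M := by exact_mod_cast hM
    refine add_le_add le_rfl (lintegral_mono fun x => ENNReal.ofReal_le_ofReal
      (Real.log_le_log (div_pos (by push_cast; positivity) (by positivity)) ?_))
    rw [Nat.cast_add]
    refine div_le_div_of_nonneg_left (by positivity) (lt_max_of_lt_left one_pos)
      (max_le ?_ (Nat.lt_floor_add_one _).le)
    linarith [Nat.cast_nonneg (α := ℝ) ⌊M * q (x 1) x⌋₊]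

theorem rokhlinShift_le_letterEnt
    (hinv : ∀ g : G, MeasurePreserving (shiftAct g) κ κ) (hγ : Measurable γ) (hA : Kraft A)
    (ho : Measurable[itinAlg γ] o) (ho0 : ∀ x, 0 ≤ o x)
    (hsep : ∀ g : G, g ≠ 1 → ∀ᵐ x ∂κ, o (shiftAct g x) ≠ o x) :
    rokhlinShift G κ ≤ ∫⁻ x, ENNReal.ofReal (A (γ x)) ∂κ +
      letterEnt (pastAlg γ o) κ (fun x => x 1) := by
  classical
  have ha : Measurable fun x : G → L => x 1 := measurable_pi_apply 1
  set s := TopologicalSpace.denseSeq ℝ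
  have hs : DenseRange s := TopologicalSpace.denseRange_denseSeq ℝ
  have hF : pastAlg γ o ≤ (inferInstance : MeasurableSpace (G → L)) := pastAlg_le_borel hγ ho
  set q := letterProb (pastAlg γ o) κ fun x : G → L => x 1 with hq
  set qn := fun n => letterProb (levelFiltration hγ ho s n) κ fun x : G → L => x 1 with hqn
  have hlim : ∀ᵐ x ∂κ, ∀ ℓ, Filter.Tendsto (fun n => qn n ℓ x) Filter.atTop (nhds (q ℓ x)) := by
    rw [ae_all_iff]
    intro ℓ
    have h1 := tendsto_ae_condExp (μ := κ) (ℱ := levelFiltration hγ ho s)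
      ({y : G → L | y 1 = ℓ}.indicator fun _ => (1 : ℝ))
    have h2 : ∀ᵐ x ∂κ, ∀ n, qn n ℓ x = _ := ae_all_iff.2 fun n =>
      letterProb_ae_eq (κ := κ) ((levelFiltration hγ ho s).le n) ha ℓ
    rw [iSup_levelFiltration hγ ho hs] at h1
    filter_upwards [h1, h2, letterProb_ae_eq (κ := κ) hF ha ℓ] with x hx1 hx2 hx3
    simp only [hx2]
    rw [hq, hx3]
    exact hx1
  have key : ∀ M : ℕ, 1 ≤ M → rokhlinShift G κ ≤ ∫⁻ x, ENNReal.ofReal (A (γ x)) ∂κ +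
      ENNReal.ofReal (1 / (M : ℝ)) + (ENNReal.ofReal (Real.log ((M + Fintype.card L : ℝ) / M)) +
        letterEnt (pastAlg γ o) κ (fun x => x 1)) := by
    intro M hM
    have hM1 : (1 : ℝ) ≤ M := by exact_mod_cast hM
    have hL : (0 : ℝ) ≤ Fintype.card L := Nat.cast_nonneg _
    set ψ : ℝ → ℝ≥0∞ := fun t => ENNReal.ofReal (Real.log ((M + Fintype.card L : ℝ) /
      max 1 (M * t))) with hψ
    have hmax : ∀ t : ℝ, 0 < max 1 (M * t) := fun t => lt_max_of_lt_left one_pos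
    have hψc : Continuous ψ := by
      refine ENNReal.continuous_ofReal.comp (Continuous.log ?_ fun t => ?_)
      · exact continuous_const.div (by fun_prop) fun t => (hmax t).ne'
      · have := hmax t; positivity
    have hmeas : ∀ f : L → (G → L) → ℝ, (∀ ℓ, Measurable (f ℓ)) →
        Measurable fun x => ψ (f (x 1) x) := by
      intro f hf
      have h1 : Measurable fun z : L × (G → L) => f z.1 z.2 :=
        measurable_from_prod_countable_right fun ℓ => hf ℓ
      exact hψc.measurable.comp (h1.comp (ha.prodMk measurable_id))
    have hlim2 : Filter.Tendsto (fun n => ∫⁻ x, ψ (qn n (x 1) x) ∂κ) Filter.atTop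
        (nhds (∫⁻ x, ψ (q (x 1) x) ∂κ)) := by
      refine tendsto_lintegral_of_dominated_convergence
        (fun _ => ENNReal.ofReal (Real.log (M + Fintype.card L : ℝ))) (fun n => ?_) (fun n => ?_)
        (by simp) ?_
      · exact hmeas _ fun ℓ => (measurable_letterProb ha ℓ).mono
          ((levelFiltration hγ ho s).le n) le_rfl
      · refine Filter.Eventually.of_forall fun x => ENNReal.ofReal_le_ofReal ?_
        refine Real.log_le_log ?_ (div_le_self (by positivity) (le_max_left _ _))
        have := hmax (qn n (x 1) x); positivity
      · filter_upwards [hlim] with x hx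
        exact (hψc.tendsto _).comp (hx (x 1))
    have h1 : rokhlinShift G κ ≤ ∫⁻ x, ENNReal.ofReal (A (γ x)) ∂κ +
        ENNReal.ofReal (1 / (M : ℝ)) + ∫⁻ x, ψ (q (x 1) x) ∂κ :=
      ge_of_tendsto' (hlim2.const_add _) fun n =>
        rokhlinShift_le_lintegral_log hinv hγ hA ho ho0 hsep (by positivity) s n M hM
    refine h1.trans ?_
    gcongr
    rw [lintegral_letter (f := fun ℓ x => ψ (q ℓ x)) hF ha fun ℓ =>
      hψc.measurable.comp (measurable_letterProb ha ℓ), letterEnt]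
    calc _ ≤ ∫⁻ x, ∑ ℓ, (ENNReal.ofReal (q ℓ x) *
            ENNReal.ofReal (Real.log ((M + Fintype.card L : ℝ) / M)) +
            ENNReal.ofReal (Real.negMulLog (q ℓ x))) ∂κ :=
          lintegral_mono fun x => Finset.sum_le_sum fun ℓ _ => ofReal_mul_log_le
            (letterProb_nonneg ℓ x) (letterProb_le_one ℓ x) hM1 (by linarith)
      _ = ∫⁻ x, (ENNReal.ofReal (Real.log ((M + Fintype.card L : ℝ) / M)) +
            ∑ ℓ, ENNReal.ofReal (Real.negMulLog (q ℓ x))) ∂κ := by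
          refine lintegral_congr fun x => ?_
          rw [Finset.sum_add_distrib, ← Finset.sum_mul,
            ← ENNReal.ofReal_sum_of_nonneg fun ℓ _ => letterProb_nonneg ℓ x, sum_letterProb ha]
          simp
      _ = _ := by rw [lintegral_add_left measurable_const]; simp [hq]
  have hlimM : Filter.Tendsto (fun M : ℕ => ∫⁻ x, ENNReal.ofReal (A (γ x)) ∂κ +
      ENNReal.ofReal (1 / (M : ℝ)) + (ENNReal.ofReal (Real.log ((M + Fintype.card L : ℝ) / M)) +
        letterEnt (pastAlg γ o) κ (fun x => x 1))) Filter.atTop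
      (nhds (∫⁻ x, ENNReal.ofReal (A (γ x)) ∂κ + ENNReal.ofReal 0 +
        (ENNReal.ofReal (Real.log 1) + letterEnt (pastAlg γ o) κ (fun x => x 1)))) := by
    refine (tendsto_const_nhds.add (ENNReal.tendsto_ofReal tendsto_one_div_atTop_nhds_zero_nat)).add
      ((ENNReal.tendsto_ofReal ?_).add tendsto_const_nhds)
    refine Filter.Tendsto.log ?_ one_ne_zero
    have h1 : Filter.Tendsto (fun M : ℕ => 1 + (Fintype.card L : ℝ) * (1 / (M : ℝ))) Filter.atTop
        (nhds (1 + (Fintype.card L : ℝ) * 0)) :=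
      (tendsto_one_div_atTop_nhds_zero_nat.const_mul _).const_add _
    rw [mul_zero, add_zero] at h1
    refine h1.congr' ?_
    filter_upwards [Filter.eventually_ge_atTop 1] with M hM
    have : (M : ℝ) ≠ 0 := by positivity
    field_simp
  have := ge_of_tendsto hlimM (Filter.eventually_atTop.2 ⟨1, key⟩)
  simpa using this

end Limit

/-! ### Products of transition probabilities along an orbit -/

theorem measurable_pastAlg_indicator_shiftAct {G L : Type*} [Group G] {γ : (G → L) → ℕ}
    {o : (G → L) → ℝ} (ho : Measurable[itinAlg γ] o) (h : G)
    {f : (G → L) → ℝ≥0∞} (hf : Measurable[pastAlg γ o] f) :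
    Measurable[pastAlg γ o]
      ({x | o (shiftAct h x) < o x}.indicator fun x => f (shiftAct h x)) := by
  intro D hD
  have hlt : MeasurableSet[pastAlg γ o] {x | o (shiftAct h x) < o x} :=
    itinAlg_le_pastAlg _ (measurableSet_lt_itinAlg' ho h)
  have h1 := measurableSet_pastAlg_shiftAct ho h (hf hD)
  rw [Set.indicator_preimage, Set.ite]
  refine MeasurableSet.union ?_ (MeasurableSet.diff ?_ hlt)
  · have : (fun x => f (shiftAct h x)) ⁻¹' D ∩ {x | o (shiftAct h x) < o x} =
        {x | o (shiftAct h x) < o x ∧ shiftAct h x ∈ f ⁻¹' D} := by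
      ext x; exact and_comm
    rw [this]; exact h1
  · exact @measurable_zero _ _ _ (pastAlg γ o) _ _ hD

theorem measurable_pastAlg_indicator_letter {G L : Type*} [Group G] [Fintype L]
    {γ : (G → L) → ℕ} {o : (G → L) → ℝ}
    (ho : Measurable[itinAlg γ] o) (h : G) {k : L → (G → L) → ℝ≥0∞}
    (hk : ∀ a, Measurable[pastAlg γ o] (k a)) :
    Measurable[pastAlg γ o] ({x | o (shiftAct h x) < o x}.indicator
      fun x => k (shiftAct h x 1) (shiftAct h x)) := by
  classical
  have h1 : ({x | o (shiftAct h x) < o x}.indicator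
      fun x => k (shiftAct h x 1) (shiftAct h x)) = fun x => ∑ a,
        {x | o (shiftAct h x) < o x ∧ x h⁻¹ = a}.indicator
          ({x | o (shiftAct h x) < o x}.indicator fun x => k a (shiftAct h x)) x := by
    funext x
    have hx1 : shiftAct h x 1 = x h⁻¹ := by simp [shiftAct]
    by_cases hx : o (shiftAct h x) < o x
    · rw [Finset.sum_eq_single (x h⁻¹)]
      · simp [hx, hx1]
      · intro a _ ha
        rw [Set.indicator_of_notMem]
        exact fun h => ha h.2.symm
      · simp
    · rw [Set.indicator_of_notMem (show x ∉ {x | o (shiftAct h x) < o x} from hx),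
        Finset.sum_eq_zero]
      intro a _
      rw [Set.indicator_of_notMem]
      exact fun h => hx h.1
  rw [h1]
  refine @Finset.measurable_fun_sum _ _ _ _ _ _ (pastAlg γ o) _ _ fun a _ => ?_
  exact (measurable_pastAlg_indicator_shiftAct ho h (hk a)).indicator
    (measurableSet_pastAlg_letter h a)

/-- Letters sampled along an orbit with transition probabilities given by the past are
independent of the itinerary and of each other. -/
theorem lintegral_mul_prod_letter {G L : Type*} [Group G] [Countable G] [Fintype L]
    [MeasurableSpace L] [MeasurableSingletonClass L] [StandardBorelSpace L]
    {κ : Measure (G → L)} [IsProbabilityMeasure κ] {γ : (G → L) → ℕ} {o : (G → L) → ℝ}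
    (hinv : ∀ g : G, MeasurePreserving (shiftAct g) κ κ) (hγ : Measurable γ)
    (ho : Measurable[itinAlg γ] o)
    (hsep : ∀ g : G, g ≠ 1 → ∀ᵐ x ∂κ, o (shiftAct g x) ≠ o x)
    {k : G → L → (G → L) → ℝ≥0∞} (hk : ∀ g a, Measurable[pastAlg γ o] (k g a)) {c : G → ℝ≥0∞}
    (hc : ∀ g x, ∑ a, ENNReal.ofReal (letterProb (pastAlg γ o) κ (fun x : G → L => x 1) a x) *
      k g a x = c g) (s : Finset G) :
    ∀ f : (G → L) → ℝ≥0∞, Measurable[itinAlg γ] f →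
      ∫⁻ x, f x * ∏ g ∈ s, k g (shiftAct g⁻¹ x 1) (shiftAct g⁻¹ x) ∂κ =
        (∏ g ∈ s, c g) * ∫⁻ x, f x ∂κ := by
  classical
  have ha : Measurable fun x : G → L => x 1 := measurable_pi_apply 1
  have hI := itinAlg_le hγ
  have hF : pastAlg γ o ≤ (inferInstance : MeasurableSpace (G → L)) := pastAlg_le_borel hγ ho
  have hKm : ∀ g, Measurable fun x : G → L => k g (x 1) x := fun g => by
    have h1 : Measurable fun z : L × (G → L) => k g z.1 z.2 :=
      measurable_from_prod_countable_right fun ℓ => (hk g ℓ).mono hF le_rfl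
    exact h1.comp (ha.prodMk measurable_id)
  have hdist : ∀ᵐ x ∂κ, ∀ g h : G, g ≠ h → o (shiftAct g⁻¹ x) ≠ o (shiftAct h⁻¹ x) := by
    have h1 : ∀ᵐ x ∂κ, ∀ g : G, g ≠ 1 → o (shiftAct g x) ≠ o x := by
      rw [ae_all_iff]
      intro g
      by_cases hg : g = 1
      · exact Filter.Eventually.of_forall fun x h => absurd hg h
      · filter_upwards [hsep g hg] with x hx _ using hx
    filter_upwards [ae_forall_shiftAct hinv h1] with x hx g h hgh
    have h2 := hx h⁻¹ (g⁻¹ * h) fun h3 => hgh (by rwa [inv_mul_eq_one] at h3)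
    rwa [← shiftAct_mul, mul_assoc, mul_inv_cancel, mul_one] at h2
  induction s using Finset.strongInduction with
  | H s ih =>
  intro f hf
  rcases s.eq_empty_or_nonempty with rfl | hs
  · simp
  set E : G → Set (G → L) := fun g₀ =>
    {x | ∀ g ∈ s.erase g₀, o (shiftAct g⁻¹ x) < o (shiftAct g₀⁻¹ x)} with hE
  have hEm : ∀ g₀, MeasurableSet[itinAlg γ] (E g₀) := fun g₀ => by
    have : E g₀ = ⋂ g ∈ s.erase g₀, {x | o (shiftAct g⁻¹ x) < o (shiftAct g₀⁻¹ x)} := by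
      ext x; simp [hE]
    rw [this]
    exact Finset.measurableSet_biInter _ fun g _ => measurableSet_lt_itinAlg ho _ _
  have hsum : ∀ᵐ x ∂κ, ∑ g₀ ∈ s, (E g₀).indicator f x = f x := by
    filter_upwards [hdist] with x hx
    obtain ⟨g₀, hg₀, hmax⟩ := s.exists_max_image (fun g => o (shiftAct g⁻¹ x)) hs
    rw [Finset.sum_eq_single_of_mem g₀ hg₀, Set.indicator_of_mem]
    · intro g hg
      rw [Finset.mem_erase] at hg
      exact lt_of_le_of_ne (hmax g hg.2) (hx g g₀ hg.1)
    · intro g hg hne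
      refine Set.indicator_of_notMem (fun h => ?_) _
      have h1 : o (shiftAct g₀⁻¹ x) < o (shiftAct g⁻¹ x) :=
        h g₀ (Finset.mem_erase.2 ⟨hne.symm, hg₀⟩)
      exact absurd h1 (not_lt.2 (hmax g hg))
  have hterm : ∀ g₀ ∈ s, ∫⁻ x, (E g₀).indicator f x *
      ∏ g ∈ s, k g (shiftAct g⁻¹ x 1) (shiftAct g⁻¹ x) ∂κ =
      (∏ g ∈ s, c g) * ∫⁻ x, (E g₀).indicator f x ∂κ := by
    intro g₀ hg₀
    set Φ : (G → L) → ℝ≥0∞ := fun y => (E g₀).indicator f (shiftAct g₀ y) *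
      ∏ g ∈ s.erase g₀, k g (shiftAct g⁻¹ (shiftAct g₀ y) 1) (shiftAct g⁻¹ (shiftAct g₀ y))
      with hΦ
    have hΦe : Φ = fun y => f (shiftAct g₀ y) * ∏ g ∈ s.erase g₀,
        {x | o (shiftAct (g⁻¹ * g₀) x) < o x}.indicator (fun x =>
          k g (shiftAct (g⁻¹ * g₀) x 1) (shiftAct (g⁻¹ * g₀) x)) y := by
      funext y
      have hmem : shiftAct g₀ y ∈ E g₀ ↔
          ∀ g ∈ s.erase g₀, o (shiftAct (g⁻¹ * g₀) y) < o y := by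
        change (∀ g ∈ s.erase g₀, o (shiftAct g⁻¹ (shiftAct g₀ y)) <
          o (shiftAct g₀⁻¹ (shiftAct g₀ y))) ↔ _
        simp only [← shiftAct_mul, inv_mul_cancel, shiftAct_one]
      by_cases hy : shiftAct g₀ y ∈ E g₀
      · simp only [hΦ, Set.indicator_of_mem hy]
        congr 1
        refine Finset.prod_congr rfl fun g hg => ?_
        rw [Set.indicator_of_mem (show y ∈ {x | o (shiftAct (g⁻¹ * g₀) x) < o x} from
          hmem.1 hy g hg), shiftAct_mul]
      · simp only [hΦ, Set.indicator_of_notMem hy, zero_mul]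
        rw [hmem] at hy
        push Not at hy
        obtain ⟨g, hg, hlt⟩ := hy
        rw [Finset.prod_eq_zero hg, mul_zero]
        exact Set.indicator_of_notMem
          (show y ∉ {x | o (shiftAct (g⁻¹ * g₀) x) < o x} from not_lt.2 hlt) _
    have hΦm : Measurable[pastAlg γ o] Φ := by
      rw [hΦe]
      refine Measurable.mul ?_ ?_
      · exact (hf.comp (measurable_shiftAct_itinAlg g₀)).mono itinAlg_le_pastAlg le_rfl
      · refine @Finset.measurable_fun_prod _ _ _ _ _ _ (pastAlg γ o) _ _ fun g _ => ?_
        exact measurable_pastAlg_indicator_letter ho _ (hk g)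
    have hΦB : Measurable Φ := hΦm.mono hF le_rfl
    have hback : ∀ x, Φ (shiftAct g₀⁻¹ x) = (E g₀).indicator f x *
        ∏ g ∈ s.erase g₀, k g (shiftAct g⁻¹ x 1) (shiftAct g⁻¹ x) := fun x => by
      simp only [hΦ]
      rw [← shiftAct_mul g₀ g₀⁻¹ x, mul_inv_cancel, shiftAct_one]
    calc ∫⁻ x, (E g₀).indicator f x * ∏ g ∈ s, k g (shiftAct g⁻¹ x 1) (shiftAct g⁻¹ x) ∂κ
        = ∫⁻ x, (fun y => Φ y * k g₀ (y 1) y) (shiftAct g₀⁻¹ x) ∂κ := by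
          refine lintegral_congr fun x => ?_
          rw [← Finset.mul_prod_erase s _ hg₀]
          simp only [hback]
          ring
      _ = ∫⁻ y, Φ y * k g₀ (y 1) y ∂κ :=
          (hinv g₀⁻¹).lintegral_comp (hΦB.mul (hKm g₀))
      _ = ∫⁻ y, ∑ a, ENNReal.ofReal (letterProb (pastAlg γ o) κ (fun x : G → L => x 1) a y) *
            (Φ y * k g₀ a y) ∂κ :=
          lintegral_letter (f := fun a y => Φ y * k g₀ a y) hF ha fun a => hΦm.mul (hk g₀ a)
      _ = ∫⁻ y, c g₀ * Φ y ∂κ := by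
          refine lintegral_congr fun y => ?_
          rw [← hc g₀ y, Finset.sum_mul]
          exact Finset.sum_congr rfl fun a _ => by ring
      _ = c g₀ * ∫⁻ y, Φ y ∂κ := lintegral_const_mul _ hΦB
      _ = c g₀ * ∫⁻ x, Φ (shiftAct g₀⁻¹ x) ∂κ := by
          rw [(hinv g₀⁻¹).lintegral_comp hΦB]
      _ = (∏ g ∈ s, c g) * ∫⁻ x, (E g₀).indicator f x ∂κ := by
          simp only [hback]
          rw [ih _ (Finset.erase_ssubset hg₀) _ (hf.indicator (hEm g₀)), ← mul_assoc,
            Finset.mul_prod_erase s c hg₀]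
  have hPm : Measurable fun x : G → L => ∏ g ∈ s, k g (shiftAct g⁻¹ x 1) (shiftAct g⁻¹ x) :=
    Finset.measurable_fun_prod _ fun g _ => (hKm g).comp (measurable_shiftAct g⁻¹)
  have hfm : ∀ g₀, Measurable ((E g₀).indicator f) := fun g₀ =>
    (hf.indicator (hEm g₀)).mono hI le_rfl
  calc ∫⁻ x, f x * ∏ g ∈ s, k g (shiftAct g⁻¹ x 1) (shiftAct g⁻¹ x) ∂κ
      = ∫⁻ x, ∑ g₀ ∈ s, (E g₀).indicator f x *
          ∏ g ∈ s, k g (shiftAct g⁻¹ x 1) (shiftAct g⁻¹ x) ∂κ := by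
        refine lintegral_congr_ae ?_
        filter_upwards [hsum] with x hx
        rw [← Finset.sum_mul, hx]
    _ = ∑ g₀ ∈ s, (∏ g ∈ s, c g) * ∫⁻ x, (E g₀).indicator f x ∂κ := by
        rw [lintegral_finsetSum s fun g₀ _ =>
          show Measurable fun x => (E g₀).indicator f x * _ from (hfm g₀).mul hPm]
        exact Finset.sum_congr rfl hterm
    _ = (∏ g ∈ s, c g) * ∫⁻ x, ∑ g₀ ∈ s, (E g₀).indicator f x ∂κ := by
        rw [lintegral_finsetSum _ fun g₀ _ => hfm g₀, Finset.mul_sum]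
    _ = (∏ g ∈ s, c g) * ∫⁻ x, f x ∂κ := by rw [lintegral_congr_ae hsum]

/-! ### Maximal couplings of letter distributions -/

section Transfer

variable {L : Type*} [Fintype L]

/-- The total variation distance of two finite distributions. -/
noncomputable def tvDist (p q : L → ℝ) : ℝ := ∑ ℓ, max (p ℓ - q ℓ) 0

open Classical in
/-- The transition probabilities of the maximal coupling from `q` to `p`. -/
noncomputable def transfer (p q : L → ℝ) (a b : L) : ℝ :=
  (if a = b then min 1 (p a / q a) else 0) +
    (1 - min 1 (p a / q a)) * (if tvDist p q = 0 then p b else max (p b - q b) 0 / tvDist p q)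

theorem tvDist_nonneg (p q : L → ℝ) : 0 ≤ tvDist p q :=
  Finset.sum_nonneg fun _ _ => le_max_right _ _

theorem tvDist_comm {p q : L → ℝ} (h : ∑ ℓ, p ℓ = ∑ ℓ, q ℓ) : tvDist p q = tvDist q p := by
  have h1 : ∀ a b : ℝ, max (a - b) 0 = max (b - a) 0 + (a - b) := fun a b => by
    rcases le_total a b with hab | hab
    · rw [max_eq_right (by linarith), max_eq_left (by linarith)]; ring
    · rw [max_eq_left (by linarith), max_eq_right (by linarith)]; ring
  unfold tvDist
  rw [Finset.sum_congr rfl fun ℓ _ => h1 (p ℓ) (q ℓ), Finset.sum_add_distrib,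
    Finset.sum_sub_distrib, h]
  ring

variable {p q : L → ℝ}

theorem mul_min_one_div {a b : ℝ} (ha : 0 ≤ a) (hb : 0 ≤ b) : a * min 1 (b / a) = min a b := by
  rcases ha.eq_or_lt with rfl | ha
  · simp [hb]
  · rw [mul_min_of_nonneg _ _ ha.le, mul_one, mul_div_cancel₀ _ ha.ne']

theorem transfer_self_ge (hp : ∀ ℓ, 0 ≤ p ℓ) (a : L) : min 1 (p a / q a) ≤ transfer p q a a := by
  rw [transfer, if_pos rfl]
  refine le_add_of_nonneg_right (mul_nonneg (sub_nonneg.2 (min_le_left _ _)) ?_)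
  split_ifs
  · exact hp a
  · exact div_nonneg (le_max_right _ _) (tvDist_nonneg p q)

theorem transfer_nonneg (hp : ∀ ℓ, 0 ≤ p ℓ) (hq : ∀ ℓ, 0 ≤ q ℓ) (a b : L) :
    0 ≤ transfer p q a b := by
  refine add_nonneg ?_ (mul_nonneg (sub_nonneg.2 (min_le_left _ _)) ?_)
  · split_ifs
    · exact le_min zero_le_one (div_nonneg (hp a) (hq a))
    · exact le_rfl
  · split_ifs
    · exact hp b
    · exact div_nonneg (le_max_right _ _) (tvDist_nonneg p q)

theorem sum_transfer (hp1 : ∑ ℓ, p ℓ = 1) (a : L) : ∑ b, transfer p q a b = 1 := by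
  classical
  unfold transfer
  rw [Finset.sum_add_distrib, ← Finset.mul_sum]
  have h1 : ∑ b, (if tvDist p q = 0 then p b else max (p b - q b) 0 / tvDist p q) = 1 := by
    split_ifs with h
    · exact hp1
    · rw [← Finset.sum_div]
      exact div_self h
  rw [h1]
  simp

theorem sum_mul_transfer (hp : ∀ ℓ, 0 ≤ p ℓ) (hq : ∀ ℓ, 0 ≤ q ℓ) (hp1 : ∑ ℓ, p ℓ = 1)
    (hq1 : ∑ ℓ, q ℓ = 1) (b : L) : ∑ a, q a * transfer p q a b = p b := by
  classical
  have hmin : ∀ a b : ℝ, a - min a b = max (a - b) 0 := fun a b => by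
    rcases le_total a b with h | h
    · rw [min_eq_left h, max_eq_right (by linarith)]; ring
    · rw [min_eq_right h, max_eq_left (by linarith)]
  have h1 : ∑ a, q a * (1 - min 1 (p a / q a)) = tvDist p q := by
    rw [tvDist_comm (hp1.trans hq1.symm), tvDist]
    refine Finset.sum_congr rfl fun a _ => ?_
    rw [mul_sub, mul_one, mul_min_one_div (hq a) (hp a), hmin]
  unfold transfer
  simp only [mul_add, ← mul_assoc, Finset.sum_add_distrib, ← Finset.sum_mul]
  rw [h1, Finset.sum_eq_single b (fun a _ hab => by simp [hab]) (by simp), if_pos rfl,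
    mul_min_one_div (hq b) (hp b)]
  have h2 : tvDist p q * (if tvDist p q = 0 then p b else max (p b - q b) 0 / tvDist p q) =
      max (p b - q b) 0 := by
    split_ifs with h
    · rw [h, zero_mul]
      exact ((Finset.sum_eq_zero_iff_of_nonneg fun _ _ => le_max_right _ _).1 h b
        (Finset.mem_univ b)).symm
    · exact mul_div_cancel₀ _ h
  rw [h2, min_comm, ← hmin]
  ring

theorem mul_one_sub_transfer_le (hp : ∀ ℓ, 0 ≤ p ℓ) (hq : ∀ ℓ, 0 ≤ q ℓ) (a : L) :
    q a * (1 - transfer p q a a) ≤ max (q a - p a) 0 := by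
  calc q a * (1 - transfer p q a a) ≤ q a * (1 - min 1 (p a / q a)) :=
        mul_le_mul_of_nonneg_left (by linarith [transfer_self_ge (q := q) hp a]) (hq a)
    _ = q a - min (q a) (p a) := by rw [mul_sub, mul_one, mul_min_one_div (hq a) (hp a)]
    _ ≤ _ := by
        rcases le_total (q a) (p a) with h | h
        · rw [min_eq_left h, sub_self]; exact le_max_right _ _
        · rw [min_eq_right h]; exact le_max_left _ _

theorem measurable_transfer (p : L → ℝ) (a b : L) :
    Measurable fun q : L → ℝ => transfer p q a b := by
  classical
  have h0 : Measurable fun q : L → ℝ => tvDist p q := by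
    unfold tvDist
    fun_prop
  have h1 : Measurable fun q : L → ℝ =>
      if tvDist p q = 0 then p b else max (p b - q b) 0 / tvDist p q :=
    Measurable.ite (h0 (measurableSet_singleton 0)) measurable_const (by fun_prop)
  unfold transfer
  by_cases hab : a = b
  · simp only [if_pos hab]; fun_prop
  · simp only [if_neg hab]; fun_prop

end Transfer

/-- A measurable family of finite distributions can be sampled measurably from a uniform
random variable. -/
theorem exists_measurable_sampling {X L : Type*} [MeasurableSpace X] [Fintype L]
    [MeasurableSpace L] [MeasurableSingletonClass L] [StandardBorelSpace L] [Nonempty L]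
    {w : X → L → ℝ} (hw : ∀ b, Measurable fun x => w x b) (hw0 : ∀ x b, 0 ≤ w x b)
    (hw1 : ∀ x, ∑ b, w x b = 1) :
    ∃ φ : X → unitInterval → L, Measurable (Function.uncurry φ) ∧ ∀ x (B : Set L),
      volume {u | φ x u ∈ B} = ∑ b, ENNReal.ofReal (w x b) * B.indicator 1 b := by
  classical
  have hB : ∀ B : Set L, MeasurableSet B := fun B => B.toFinite.measurableSet
  set T : X → Measure L := fun x => ∑ b, ENNReal.ofReal (w x b) • Measure.dirac b with hT
  have hTB : ∀ x B, T x B = ∑ b, ENNReal.ofReal (w x b) * B.indicator 1 b := fun x B => by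
    simp [hT, Measure.finsetSum_apply]
  let K : ProbabilityTheory.Kernel X L :=
    { toFun := T
      measurable' := Measure.measurable_of_measurable_coe _ fun B _ => by
        simp only [hTB]
        exact Finset.measurable_fun_sum _ fun b _ => (hw b).ennreal_ofReal.mul_const _ }
  have hK : ProbabilityTheory.IsMarkovKernel K := ⟨fun x => ⟨by
    change T x Set.univ = 1
    rw [hTB]
    simp only [Set.indicator_univ, Pi.one_apply, mul_one]
    rw [← ENNReal.ofReal_sum_of_nonneg fun b _ => hw0 x b, hw1, ENNReal.ofReal_one]⟩⟩
  obtain ⟨φ, hφ, hφK⟩ := K.exists_measurable_map_eq_unitInterval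
  refine ⟨φ, hφ, fun x B => ?_⟩
  rw [← hTB]
  change _ = K x B
  rw [← hφK x, Measure.map_apply hφ.of_uncurry_left (hB B)]
  rfl

/-! ### Joinings obtained by sampling along orbits -/

section Joining

variable {G L : Type*} [Group G]

theorem measurePreserving_shiftAct_infinitePi {Y : Type*} [MeasurableSpace Y] (ρ : Measure Y)
    [IsProbabilityMeasure ρ] (h : G) :
    MeasurePreserving (shiftAct h) (Measure.infinitePi fun _ : G => ρ)
      (Measure.infinitePi fun _ : G => ρ) := by
  classical
  refine ⟨measurable_shiftAct h, Measure.eq_infinitePi _ fun s t ht => ?_⟩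
  rw [Measure.map_apply (measurable_shiftAct h)
    (MeasurableSet.pi s.countable_toSet fun g _ => ht g)]
  have h1 : shiftAct h ⁻¹' (s : Set G).pi t =
      ((s.image fun g => h⁻¹ * g : Finset G) : Set G).pi fun g => t (h * g) := by
    ext u
    constructor
    · intro hu g hg
      obtain ⟨g', hg', rfl⟩ := Finset.mem_image.1 hg
      simpa [shiftAct] using hu g' hg'
    · intro hu g hg
      simpa [shiftAct] using hu (h⁻¹ * g) (Finset.mem_image_of_mem _ hg)
  rw [h1, Measure.infinitePi_pi _ fun g _ => ht _, Finset.prod_image (by simp)]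
  simp

theorem IsBernoulliProd.eq_infinitePi {G L : Type*} [MeasurableSpace L] {lam : Measure L}
    [IsProbabilityMeasure lam] {μB : Measure (G → L)} (hB : IsBernoulliProd lam μB) :
    μB = Measure.infinitePi fun _ : G => lam :=
  Measure.eq_infinitePi _ fun s t ht => hB.2 s t ht

/-- The configuration obtained by applying a factor rule at every group element, each time with
its own randomness. -/
def orbitSample {Y : Type*} (φ : (G → L) → Y → L) (z : (G → L) × (G → Y)) : G → L :=
  fun g => φ (shiftAct g⁻¹ z.1) (z.2 g)

theorem measurable_orbitSample {Y : Type*} [MeasurableSpace Y] [MeasurableSpace L]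
    {φ : (G → L) → Y → L} (hφ : Measurable (Function.uncurry φ)) :
    Measurable (orbitSample φ) := by
  refine measurable_pi_lambda _ fun g => ?_
  have h1 : Measurable fun z : (G → L) × (G → Y) => (shiftAct g⁻¹ z.1, z.2 g) :=
    ((measurable_shiftAct g⁻¹).comp measurable_fst).prodMk
      ((measurable_pi_apply g).comp measurable_snd)
  exact hφ.comp h1

theorem orbitSample_shiftAct {Y : Type*} (φ : (G → L) → Y → L) (h : G)
    (z : (G → L) × (G → Y)) :
    orbitSample φ (shiftAct h z.1, shiftAct h z.2) = shiftAct h (orbitSample φ z) := by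
  funext g
  simp only [orbitSample, ← shiftAct_mul]
  simp [shiftAct, orbitSample]

theorem isJoining_orbitSample {Y : Type*} [MeasurableSpace Y] [MeasurableSpace L]
    {κ : Measure (G → L)} [IsProbabilityMeasure κ]
    (hinv : ∀ g : G, MeasurePreserving (shiftAct g) κ κ) (ρ : Measure Y) [IsProbabilityMeasure ρ]
    {φ : (G → L) → Y → L} (hφ : Measurable (Function.uncurry φ)) {μ : Measure (G → L)}
    (hμ : (κ.prod (Measure.infinitePi fun _ : G => ρ)).map (orbitSample φ) = μ) :
    IsJoining G ((κ.prod (Measure.infinitePi fun _ : G => ρ)).map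
      fun z => (orbitSample φ z, z.1)) μ κ := by
  set P := Measure.infinitePi fun _ : G => ρ
  have hz := measurable_orbitSample hφ
  have hpair : Measurable fun z : (G → L) × (G → Y) => (orbitSample φ z, z.1) :=
    hz.prodMk measurable_fst
  refine ⟨fun h => ?_, ?_, ?_⟩
  · have hS : MeasurePreserving (Prod.map (shiftAct h) (shiftAct h)) (κ.prod P) (κ.prod P) :=
      (hinv h).prod (measurePreserving_shiftAct_infinitePi ρ h)
    have hT : Measurable fun z : (G → L) × (G → L) => (shiftAct h z.1, shiftAct h z.2) :=
      ((measurable_shiftAct h).comp measurable_fst).prodMk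
        ((measurable_shiftAct h).comp measurable_snd)
    refine ⟨hT, ?_⟩
    rw [Measure.map_map hT hpair]
    conv_rhs => rw [← hS.map_eq, Measure.map_map hpair hS.measurable]
    congr 1
    funext z
    exact Prod.ext (orbitSample_shiftAct φ h z).symm rfl
  · rw [Measure.map_map measurable_fst hpair]
    exact hμ
  · rw [Measure.map_map measurable_snd hpair]
    change Measure.map Prod.fst (κ.prod P) = κ
    rw [Measure.map_fst_prod, measure_univ, one_smul]

theorem prod_infinitePi_orbitSample {Y : Type*} [MeasurableSpace Y] [MeasurableSpace L]
    {κ : Measure (G → L)} [IsProbabilityMeasure κ] (ρ : Measure Y) [IsProbabilityMeasure ρ]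
    {φ : (G → L) → Y → L} (hφ : Measurable (Function.uncurry φ)) (s : Finset G) {t : G → Set L}
    (ht : ∀ g, MeasurableSet (t g)) :
    (κ.prod (Measure.infinitePi fun _ : G => ρ)).map (orbitSample φ) ((s : Set G).pi t) =
      ∫⁻ x, ∏ g ∈ s, ρ {u | φ (shiftAct g⁻¹ x) u ∈ t g} ∂κ := by
  have hm : MeasurableSet ((s : Set G).pi t) :=
    MeasurableSet.pi s.countable_toSet fun g _ => ht g
  rw [Measure.map_apply (measurable_orbitSample hφ) hm,
    Measure.prod_apply (measurable_orbitSample hφ hm)]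
  refine lintegral_congr fun x => ?_
  exact Measure.infinitePi_pi (t := fun g => {u | φ (shiftAct g⁻¹ x) u ∈ t g})
    (fun _ : G => ρ) fun g _ => hφ.of_uncurry_left (ht g)

end Joining

/-- The d-bar distance to a Bernoulli measure is at most the mean total variation distance from
the base measure to the law of a letter given its past. -/
theorem dbar_le_lintegral_tvDist {G L : Type*} [Group G] [Countable G] [Fintype L] [Nonempty L]
    [MeasurableSpace L] [MeasurableSingletonClass L] [StandardBorelSpace L]
    {lam : Measure L} [IsProbabilityMeasure lam] {μB : Measure (G → L)}
    (hB : IsBernoulliProd lam μB)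
    {κ : Measure (G → L)} [IsProbabilityMeasure κ] {γ : (G → L) → ℕ} {o : (G → L) → ℝ}
    (hinv : ∀ g : G, MeasurePreserving (shiftAct g) κ κ) (hγ : Measurable γ)
    (ho : Measurable[itinAlg γ] o)
    (hsep : ∀ g : G, g ≠ 1 → ∀ᵐ x ∂κ, o (shiftAct g x) ≠ o x) :
    dbar G μB κ ≤ ∫⁻ x, ENNReal.ofReal (tvDist (fun ℓ => (lam {ℓ}).toReal)
      fun ℓ => letterProb (pastAlg γ o) κ (fun x : G → L => x 1) ℓ x) ∂κ := by
  classical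
  have ha : Measurable fun x : G → L => x 1 := measurable_pi_apply 1
  have hF : pastAlg γ o ≤ (inferInstance : MeasurableSpace (G → L)) := pastAlg_le_borel hγ ho
  have hL : ∀ B : Set L, MeasurableSet B := fun B => B.toFinite.measurableSet
  set p : L → ℝ := fun ℓ => (lam {ℓ}).toReal with hp
  set q : (G → L) → L → ℝ := fun x ℓ =>
    letterProb (pastAlg γ o) κ (fun x : G → L => x 1) ℓ x with hq
  have hp0 : ∀ ℓ, 0 ≤ p ℓ := fun ℓ => ENNReal.toReal_nonneg
  have hlam : ∀ B : Set L, ∑ b, ENNReal.ofReal (p b) * B.indicator 1 b = lam B := fun B => by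
    have h1 : lam B = ∑ b ∈ B.toFinite.toFinset, lam {b} := by
      rw [sum_measure_singleton, Set.Finite.coe_toFinset]
    rw [h1, ← Finset.sum_subset (Finset.subset_univ B.toFinite.toFinset)]
    · refine Finset.sum_congr rfl fun b hb => ?_
      rw [Set.indicator_of_mem ((Set.Finite.mem_toFinset _).1 hb), Pi.one_apply, mul_one, hp,
        ENNReal.ofReal_toReal (measure_ne_top _ _)]
    · intro b _ hb
      rw [Set.indicator_of_notMem fun h => hb ((Set.Finite.mem_toFinset _).2 h), mul_zero]
  have hp1 : ∑ ℓ, p ℓ = 1 := by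
    have h1 := hlam Set.univ
    simp only [Set.indicator_univ, Pi.one_apply, mul_one, measure_univ] at h1
    rw [← ENNReal.ofReal_sum_of_nonneg fun b _ => hp0 b] at h1
    simpa using h1
  have hq0 : ∀ x ℓ, 0 ≤ q x ℓ := fun x ℓ => letterProb_nonneg ℓ x
  have hq1 : ∀ x, ∑ ℓ, q x ℓ = 1 := fun x => sum_letterProb ha x
  have hqm : Measurable[pastAlg γ o] q :=
    @measurable_pi_lambda _ _ _ (pastAlg γ o) _ _ fun ℓ => measurable_letterProb ha ℓ
  have hqB : Measurable q := hqm.mono hF le_rfl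
  have hw : ∀ b, Measurable fun x : G → L => transfer p (q x) (x 1) b := fun b => by
    have h1 : Measurable fun z : L × (G → L) => transfer p (q z.2) z.1 b :=
      measurable_from_prod_countable_right fun ℓ => (measurable_transfer p ℓ b).comp hqB
    exact h1.comp (ha.prodMk measurable_id)
  obtain ⟨φ, hφ, hφv⟩ := exists_measurable_sampling (w := fun x : G → L => transfer p (q x) (x 1))
    hw (fun x b => transfer_nonneg hp0 (hq0 x) _ b) fun x => sum_transfer hp1 _
  have hmarg : (κ.prod (Measure.infinitePi fun _ : G => (volume : Measure unitInterval))).map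
      (orbitSample φ) = μB := by
    rw [hB.eq_infinitePi]
    refine Measure.eq_infinitePi _ fun s t ht => ?_
    rw [prod_infinitePi_orbitSample _ hφ s ht]
    have key := lintegral_mul_prod_letter (k := fun g a x =>
      ∑ b, ENNReal.ofReal (transfer p (q x) a b) * (t g).indicator 1 b)
      (c := fun g => lam (t g)) hinv hγ ho hsep
      (fun g a => @Finset.measurable_fun_sum _ _ _ _ _ _ (pastAlg γ o) _ _ fun b _ =>
        (((measurable_transfer p a b).comp hqm).ennreal_ofReal).mul_const _)
      (fun g x => by
        simp only [Finset.mul_sum]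
        rw [Finset.sum_comm, ← hlam (t g)]
        refine Finset.sum_congr rfl fun b _ => ?_
        rw [← sum_mul_transfer hp0 (hq0 x) hp1 (hq1 x) b,
          ENNReal.ofReal_sum_of_nonneg fun a _ =>
            mul_nonneg (hq0 x a) (transfer_nonneg hp0 (hq0 x) a b), Finset.sum_mul]
        refine Finset.sum_congr rfl fun a _ => ?_
        rw [ENNReal.ofReal_mul (hq0 x a), mul_assoc]) s (fun _ => 1) measurable_const
    simp only [one_mul, lintegral_one, measure_univ, mul_one] at key
    rw [← key]
    exact lintegral_congr fun x => Finset.prod_congr rfl fun g _ => hφv _ _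
  refine (iInf₂_le (f := fun lam (_ : IsJoining G lam μB κ) => lam {z | z.1 1 ≠ z.2 1}) _
    (isJoining_orbitSample hinv volume hφ hmarg)).trans ?_
  have hD : MeasurableSet {z : (G → L) × (G → L) | z.1 1 ≠ z.2 1} := by
    have h1 : Measurable fun z : (G → L) × (G → L) => (z.1 1, z.2 1) := by fun_prop
    have h2 : MeasurableSet {z : L × L | z.1 ≠ z.2} := Set.Finite.measurableSet (Set.toFinite _)
    exact h1 h2
  have hpair : Measurable fun z : (G → L) × (G → unitInterval) => (orbitSample φ z, z.1) :=
    (measurable_orbitSample hφ).prodMk measurable_fst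
  rw [Measure.map_apply hpair hD, Measure.prod_apply (hpair hD)]
  have hfib : ∀ x, (Measure.infinitePi fun _ : G => (volume : Measure unitInterval))
      (Prod.mk x ⁻¹' ((fun z : (G → L) × (G → unitInterval) => (orbitSample φ z, z.1)) ⁻¹'
        {z : (G → L) × (G → L) | z.1 1 ≠ z.2 1})) =
      ENNReal.ofReal (1 - transfer p (q x) (x 1) (x 1)) := fun x => by
    have h1 := Measure.infinitePi_pi (s := {1}) (t := fun _ => {u | φ x u ∈ ({x 1}ᶜ : Set L)})
      (fun _ : G => (volume : Measure unitInterval)) fun g _ => hφ.of_uncurry_left (hL _)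
    have h2 : (Prod.mk x ⁻¹' ((fun z : (G → L) × (G → unitInterval) => (orbitSample φ z, z.1)) ⁻¹'
        {z : (G → L) × (G → L) | z.1 1 ≠ z.2 1})) =
        ((({1} : Finset G) : Set G).pi fun _ => {u | φ x u ∈ ({x 1}ᶜ : Set L)}) := by
      ext u
      simp [orbitSample, shiftAct_one]
    rw [h2, h1, Finset.prod_singleton, hφv]
    have h3 : ∀ b, ENNReal.ofReal (transfer p (q x) (x 1) b) * ({x 1}ᶜ : Set L).indicator 1 b =
        ENNReal.ofReal (if b = x 1 then 0 else transfer p (q x) (x 1) b) := fun b => by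
      by_cases hb : b = x 1 <;> simp [hb]
    simp only [h3]
    rw [← ENNReal.ofReal_sum_of_nonneg]
    · congr 1
      have h4 := sum_transfer (q := q x) hp1 (x 1)
      rw [← Finset.add_sum_erase _ _ (Finset.mem_univ (x 1))] at h4 ⊢
      rw [if_pos rfl, zero_add, ← h4, add_sub_cancel_left]
      exact Finset.sum_congr rfl fun b hb => if_neg (Finset.ne_of_mem_erase hb)
    · intro b _
      split_ifs
      · exact le_rfl
      · exact transfer_nonneg hp0 (hq0 x) _ b
  simp only [hfib]
  have h5 := lintegral_letter (κ := κ)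
    (f := fun a x => ENNReal.ofReal (1 - transfer p (q x) a a)) hF ha fun a =>
      (((measurable_transfer p a a).comp hqm).const_sub 1).ennreal_ofReal
  rw [h5]
  refine lintegral_mono fun x => ?_
  simp only
  rw [tvDist_comm (hp1.trans (hq1 x).symm), tvDist,
    ENNReal.ofReal_sum_of_nonneg fun _ _ => le_max_right _ _]
  refine Finset.sum_le_sum fun a _ => ?_
  rw [← ENNReal.ofReal_mul (letterProb_nonneg a x)]
  exact ENNReal.ofReal_le_ofReal (mul_one_sub_transfer_le hp0 (hq0 x) a)

/-! ### Total variation and entropy -/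

theorem tvDist_triangle {L : Type*} [Fintype L] (p r q : L → ℝ) :
    tvDist p q ≤ tvDist p r + tvDist r q := by
  unfold tvDist
  rw [← Finset.sum_add_distrib]
  refine Finset.sum_le_sum fun ℓ _ => max_le ?_ ?_
  · linarith [le_max_left (p ℓ - r ℓ) 0, le_max_left (r ℓ - q ℓ) 0]
  · exact add_nonneg (le_max_right _ _) (le_max_right _ _)

theorem two_mul_sub_le_mul_log {p q : ℝ} (hp : 0 < p) (hq : 0 ≤ q) :
    (√p - √q) ^ 2 ≤ -Real.negMulLog q - q * Real.log p - q + p := by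
  rcases hq.eq_or_lt with rfl | hq
  · simp [Real.sq_sqrt hp.le]
  have hsp := Real.sqrt_pos.2 hp
  have hsq := Real.sqrt_pos.2 hq
  have h1 := Real.log_le_sub_one_of_pos (div_pos hsp hsq)
  rw [Real.log_div hsp.ne' hsq.ne', Real.log_sqrt hp.le, Real.log_sqrt hq.le] at h1
  have h2 : q * (√p / √q) = √p * √q := by
    rw [mul_div_assoc', div_eq_iff hsq.ne', mul_assoc, Real.mul_self_sqrt hq.le, mul_comm]
  have h3 := mul_le_mul_of_nonneg_left h1 hq.le
  rw [mul_sub q (√p / √q), h2] at h3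
  have h4 := Real.sq_sqrt hp.le
  have h5 := Real.sq_sqrt hq.le
  rw [Real.negMulLog]
  nlinarith

theorem max_sub_le_entropy {p q s : ℝ} (hp : 0 ≤ p) (hq : 0 ≤ q) (h0 : p = 0 → q = 0)
    (hs : 0 < s) : max (p - q) 0 ≤
      2 * s * (p + q) + (-Real.negMulLog q - q * Real.log p - q + p) / (4 * s) := by
  rcases hp.eq_or_lt with rfl | hp
  · simp [h0 rfl]
  have h1 := two_mul_sub_le_mul_log hp hq
  have h4 := Real.sq_sqrt hp.le
  have h5 := Real.sq_sqrt hq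
  have h6 : (√p - √q) ^ 2 / (4 * s) ≤
      (-Real.negMulLog q - q * Real.log p - q + p) / (4 * s) :=
    div_le_div_of_nonneg_right h1 (by positivity)
  refine max_le ?_ ?_
  · have h7 : (√p - √q) * (√p + √q) ≤ s * (√p + √q) ^ 2 + (√p - √q) ^ 2 / (4 * s) := by
      rw [← sub_nonneg]
      have : s * (√p + √q) ^ 2 + (√p - √q) ^ 2 / (4 * s) - (√p - √q) * (√p + √q) =
          (2 * s * (√p + √q) - (√p - √q)) ^ 2 / (4 * s) := by
        field_simp
        ring
      rw [this]
      positivity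
    have h8 : s * (√p + √q) ^ 2 ≤ s * (2 * (p + q)) :=
      mul_le_mul_of_nonneg_left (by nlinarith [sq_nonneg (√p - √q)]) hs.le
    nlinarith
  · have : 0 ≤ (√p - √q) ^ 2 / (4 * s) := by positivity
    have : 0 ≤ 2 * s * (p + q) := by positivity
    linarith

/-- The mean total variation distance between the law of a letter and its conditional law is
controlled by the entropy drop. -/
theorem lintegral_tvDist_letterProb_le {X L : Type*} [Fintype L] [MeasurableSpace L]
    [MeasurableSingletonClass L] {m : MeasurableSpace X} [mX : MeasurableSpace X]
    [StandardBorelSpace X] {κ : Measure X} [IsProbabilityMeasure κ] {a : X → L} (hm : m ≤ mX)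
    (ha : Measurable a) {s : ℝ} (hs : 0 < s) :
    ∫⁻ x, ENNReal.ofReal (tvDist (fun ℓ => κ.real {y | a y = ℓ})
        fun ℓ => letterProb m κ a ℓ x) ∂κ ≤
      ENNReal.ofReal (4 * s + (∑ ℓ, Real.negMulLog (κ.real {y | a y = ℓ}) -
        (letterEnt m κ a).toReal) / (4 * s)) := by
  set p : L → ℝ := fun ℓ => κ.real {y | a y = ℓ} with hp
  set q : L → X → ℝ := letterProb m κ a with hq
  have hqm : ∀ ℓ, Measurable (q ℓ) := fun ℓ => (measurable_letterProb ha ℓ).mono hm le_rfl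
  have hq0 : ∀ ℓ x, 0 ≤ q ℓ x := fun ℓ x => letterProb_nonneg ℓ x
  have hq1 : ∀ ℓ x, q ℓ x ≤ 1 := fun ℓ x => letterProb_le_one ℓ x
  have hp0 : ∀ ℓ, 0 ≤ p ℓ := fun ℓ => measureReal_nonneg
  have hqi : ∀ ℓ, Integrable (q ℓ) κ := fun ℓ =>
    Integrable.of_bound (hqm ℓ).aestronglyMeasurable 1 (Filter.Eventually.of_forall fun x => by
      rw [Real.norm_eq_abs, abs_of_nonneg (hq0 ℓ x)]; exact hq1 ℓ x)
  have hn0 : ∀ ℓ x, 0 ≤ Real.negMulLog (q ℓ x) := fun ℓ x =>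
    Real.negMulLog_nonneg (hq0 ℓ x) (hq1 ℓ x)
  have hni : ∀ ℓ, Integrable (fun x => Real.negMulLog (q ℓ x)) κ := fun ℓ => by
    refine Integrable.of_bound
      (Real.continuous_negMulLog.measurable.comp (hqm ℓ)).aestronglyMeasurable 1
      (Filter.Eventually.of_forall fun x => ?_)
    rw [Real.norm_eq_abs, abs_of_nonneg (hn0 ℓ x)]
    exact (Real.negMulLog_le_one_sub_self (hq0 ℓ x)).trans (by linarith [hq0 ℓ x])
  have hqp : ∀ ℓ, ∫ x, q ℓ x ∂κ = p ℓ := fun ℓ => by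
    have h1 := measure_inter_letter (κ := κ) hm ha ℓ (@MeasurableSet.univ _ m)
    rw [Set.univ_inter, Measure.restrict_univ] at h1
    rw [integral_eq_lintegral_of_nonneg_ae (Filter.Eventually.of_forall (hq0 ℓ))
      (hqm ℓ).aestronglyMeasurable, ← h1]
    rfl
  have hz : ∀ ℓ, p ℓ = 0 → ∀ᵐ x ∂κ, q ℓ x = 0 := fun ℓ h => by
    rw [← hqp ℓ, integral_eq_zero_iff_of_nonneg (hq0 ℓ) (hqi ℓ)] at h
    exact h
  have hp1 : ∑ ℓ, p ℓ = 1 := by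
    simp only [← hqp]
    rw [← integral_finsetSum _ fun ℓ _ => hqi ℓ]
    simp [hq, sum_letterProb ha]
  have hHF : (letterEnt m κ a).toReal = ∑ ℓ, ∫ x, Real.negMulLog (q ℓ x) ∂κ := by
    rw [← integral_finsetSum _ fun ℓ _ => hni ℓ, integral_eq_lintegral_of_nonneg_ae
      (Filter.Eventually.of_forall fun x => Finset.sum_nonneg fun ℓ _ => hn0 ℓ x)
      (integrable_finsetSum _ fun ℓ _ => hni ℓ).aestronglyMeasurable, letterEnt]
    congr 1
    refine lintegral_congr fun x => ?_
    rw [ENNReal.ofReal_sum_of_nonneg fun ℓ _ => hn0 ℓ x]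
  have hRi : ∀ ℓ, Integrable (fun x => 2 * s * (p ℓ + q ℓ x) + (-Real.negMulLog (q ℓ x) -
      q ℓ x * Real.log (p ℓ) - q ℓ x + p ℓ) / (4 * s)) κ := fun ℓ =>
    ((((integrable_const _).add (hqi ℓ)).const_mul _).add
      (((((hni ℓ).neg.sub ((hqi ℓ).mul_const _)).sub (hqi ℓ)).add
        (integrable_const _)).div_const _))
  have hR : ∀ ℓ, ∫ x, (2 * s * (p ℓ + q ℓ x) + (-Real.negMulLog (q ℓ x) -
      q ℓ x * Real.log (p ℓ) - q ℓ x + p ℓ) / (4 * s)) ∂κ =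
      4 * s * p ℓ + (Real.negMulLog (p ℓ) - ∫ x, Real.negMulLog (q ℓ x) ∂κ) / (4 * s) := by
    intro ℓ
    have e1 : ∀ x, 2 * s * (p ℓ + q ℓ x) + (-Real.negMulLog (q ℓ x) -
        q ℓ x * Real.log (p ℓ) - q ℓ x + p ℓ) / (4 * s) =
        (2 * s * p ℓ + p ℓ / (4 * s)) + ((2 * s - (Real.log (p ℓ) + 1) / (4 * s)) * q ℓ x -
          (1 / (4 * s)) * Real.negMulLog (q ℓ x)) := fun x => by
      field_simp
      ring
    simp only [e1]
    have e2 : Integrable (fun x => (2 * s - (Real.log (p ℓ) + 1) / (4 * s)) * q ℓ x -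
        (1 / (4 * s)) * Real.negMulLog (q ℓ x)) κ :=
      ((hqi ℓ).const_mul _).sub ((hni ℓ).const_mul _)
    rw [integral_add (integrable_const _) e2, integral_sub ((hqi ℓ).const_mul _) ((hni ℓ).const_mul _), integral_const_mul,
      integral_const_mul, hqp ℓ, integral_const, probReal_univ, one_smul, Real.negMulLog]
    field_simp
    ring
  have hae : ∀ᵐ x ∂κ, tvDist p (fun ℓ => q ℓ x) ≤ ∑ ℓ, (2 * s * (p ℓ + q ℓ x) +
      (-Real.negMulLog (q ℓ x) - q ℓ x * Real.log (p ℓ) - q ℓ x + p ℓ) / (4 * s)) := by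
    have h1 : ∀ᵐ x ∂κ, ∀ ℓ, p ℓ = 0 → q ℓ x = 0 := by
      rw [ae_all_iff]
      intro ℓ
      by_cases h : p ℓ = 0
      · filter_upwards [hz ℓ h] with x hx _ using hx
      · exact Filter.Eventually.of_forall fun x h' => absurd h' h
    filter_upwards [h1] with x hx
    exact Finset.sum_le_sum fun ℓ _ => max_sub_le_entropy (hp0 ℓ) (hq0 ℓ x) (hx ℓ) hs
  have hae0 : ∀ᵐ x ∂κ, 0 ≤ ∑ ℓ, (2 * s * (p ℓ + q ℓ x) +
      (-Real.negMulLog (q ℓ x) - q ℓ x * Real.log (p ℓ) - q ℓ x + p ℓ) / (4 * s)) := by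
    filter_upwards [hae] with x hx
    exact (tvDist_nonneg _ _).trans hx
  calc ∫⁻ x, ENNReal.ofReal (tvDist p fun ℓ => q ℓ x) ∂κ
      ≤ ∫⁻ x, ENNReal.ofReal (∑ ℓ, (2 * s * (p ℓ + q ℓ x) +
          (-Real.negMulLog (q ℓ x) - q ℓ x * Real.log (p ℓ) - q ℓ x + p ℓ) / (4 * s))) ∂κ := by
        refine lintegral_mono_ae ?_
        filter_upwards [hae] with x hx using ENNReal.ofReal_le_ofReal hx
    _ = ENNReal.ofReal (∫ x, ∑ ℓ, (2 * s * (p ℓ + q ℓ x) +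
          (-Real.negMulLog (q ℓ x) - q ℓ x * Real.log (p ℓ) - q ℓ x + p ℓ) / (4 * s)) ∂κ) :=
        (ofReal_integral_eq_lintegral_ofReal (integrable_finsetSum _ fun ℓ _ => hRi ℓ)
          hae0).symm
    _ = _ := by
        rw [integral_finsetSum _ fun ℓ _ => hRi ℓ, Finset.sum_congr rfl fun ℓ _ => hR ℓ,
          Finset.sum_add_distrib, ← Finset.mul_sum, hp1, mul_one, ← Finset.sum_div,
          Finset.sum_sub_distrib, hHF]

/-! ### Freeness -/

section Freeness

variable {G L : Type*} [Group G] [Fintype L] [MeasurableSpace L] [MeasurableSingletonClass L]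

theorem IsBernoulliProd.measure_apply_eq_apply {G L : Type*} [Fintype L] [MeasurableSpace L]
    [MeasurableSingletonClass L] {lam : Measure L} {μB : Measure (G → L)}
    (hB : IsBernoulliProd lam μB) {s t : G} (hst : s ≠ t) :
    μB {x | x s = x t} = ∑ ℓ, lam {ℓ} ^ 2 := by
  classical
  have h1 : {x : G → L | x s = x t} =
      ⋃ ℓ ∈ (Finset.univ : Finset L), {x | ∀ g ∈ ({s, t} : Finset G), x g ∈ ({ℓ} : Set L)} := by
    ext x
    simp only [Set.mem_iUnion, Finset.mem_univ, exists_prop, true_and]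
    constructor
    · intro hx
      refine ⟨x t, fun g hg => ?_⟩
      rcases Finset.mem_insert.1 hg with rfl | hg
      · exact hx
      · rw [Finset.mem_singleton.1 hg]; rfl
    · rintro ⟨ℓ, hx⟩
      exact (hx s (by simp)).trans (hx t (by simp)).symm
  rw [h1, measure_biUnion_finset]
  · refine Finset.sum_congr rfl fun ℓ _ => ?_
    rw [hB.2 _ (fun _ => {ℓ}) fun _ => measurableSet_singleton ℓ, Finset.prod_pair hst, sq]
  · intro i _ j _ hij
    refine Set.disjoint_left.2 fun x hx hy => hij ?_
    exact (hx s (by simp)).symm.trans (hy s (by simp))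
  · intro ℓ _
    have h2 : {x : G → L | ∀ g ∈ ({s, t} : Finset G), x g ∈ ({ℓ} : Set L)} =
        (({s, t} : Finset G) : Set G).pi fun _ => {ℓ} := rfl
    rw [h2]
    exact MeasurableSet.pi (Finset.countable_toSet _) fun _ _ => measurableSet_singleton ℓ

theorem sum_sq_lt_one {lam : Measure L} [IsProbabilityMeasure lam]
    (hne : ∀ ℓ, lam {ℓ} ≠ 1) : ∑ ℓ, lam {ℓ} ^ 2 < 1 := by
  classical
  have h1 : ∑ ℓ, lam {ℓ} = 1 := by
    rw [sum_measure_singleton, Finset.coe_univ, measure_univ]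
  obtain ⟨ℓ₀, hℓ₀⟩ : ∃ ℓ, lam {ℓ} ≠ 0 := by
    by_contra! h
    simp [h] at h1
  have hle : ∀ ℓ, lam {ℓ} ^ 2 ≤ lam {ℓ} := fun ℓ => by
    rw [sq]; exact mul_le_of_le_one_right' prob_le_one
  have hlt : lam {ℓ₀} ^ 2 < lam {ℓ₀} := by
    rw [sq]
    conv_rhs => rw [← mul_one (lam {ℓ₀})]
    exact (ENNReal.mul_lt_mul_iff_right hℓ₀ (measure_ne_top _ _)).2
      (lt_of_le_of_ne prob_le_one (hne ℓ₀))
  rw [← h1, ← Finset.add_sum_erase _ _ (Finset.mem_univ ℓ₀),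
    ← Finset.add_sum_erase _ (fun ℓ => lam {ℓ}) (Finset.mem_univ ℓ₀)]
  refine ENNReal.add_lt_add_of_lt_of_le ?_ hlt (Finset.sum_le_sum fun ℓ _ => hle ℓ)
  exact ne_top_of_le_ne_top ENNReal.one_ne_top
    ((Finset.sum_le_sum fun ℓ _ => hle ℓ).trans
      ((Finset.sum_le_sum_of_subset (Finset.erase_subset _ _)).trans h1.le))

theorem IsBernoulliProd.exists_measure_le_pow [Infinite G] {lam : Measure L}
    [IsProbabilityMeasure lam] {μB : Measure (G → L)} (hB : IsBernoulliProd lam μB)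
    {g : G} (hg : g ≠ 1) (n : ℕ) :
    ∃ T : Finset G, μB {x | ∀ t ∈ T, x t = x (g⁻¹ * t)} ≤ (∑ ℓ, lam {ℓ} ^ 2) ^ n := by
  classical
  have := hB.1
  induction n with
  | zero => exact ⟨∅, by simp⟩
  | succ n ih =>
    obtain ⟨T, hT⟩ := ih
    obtain ⟨t, ht⟩ := Infinite.exists_notMem_finset
      (T ∪ T.image (fun t => g⁻¹ * t) ∪ T.image fun t => g * t)
    simp only [Finset.mem_union, Finset.mem_image, not_or, not_exists, not_and] at ht
    obtain ⟨⟨ht1, ht2⟩, ht3⟩ := ht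
    have hne : t ≠ g⁻¹ * t := fun h => hg (by simpa using h)
    refine ⟨insert t T, ?_⟩
    set S : Finset G := T ∪ T.image fun t => g⁻¹ * t with hS
    have hdisj : Disjoint S {t, g⁻¹ * t} := by
      rw [Finset.disjoint_right]
      intro u hu hu'
      simp only [Finset.mem_insert, Finset.mem_singleton] at hu
      simp only [hS, Finset.mem_union, Finset.mem_image] at hu'
      rcases hu with rfl | rfl
      · rcases hu' with h | ⟨v, hv, h⟩
        · exact ht1 h
        · exact ht2 v hv h
      · rcases hu' with h | ⟨v, hv, h⟩
        · exact ht3 _ h (by simp)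
        · exact ht1 (by rwa [mul_left_cancel h] at hv)
    have hind : ProbabilityTheory.iIndepFun (fun (u : G) (x : G → L) => x u) μB := by
      rw [hB.eq_infinitePi]
      exact ProbabilityTheory.iIndepFun_infinitePi (X := fun _ ℓ => ℓ) fun _ => measurable_id
    have h2 := hind.indepFun_finset S {t, g⁻¹ * t} hdisj fun u => measurable_pi_apply u
    have hmS : ∀ t ∈ T, t ∈ S ∧ g⁻¹ * t ∈ S := fun t ht =>
      ⟨Finset.mem_union_left _ ht, Finset.mem_union_right _ (Finset.mem_image_of_mem _ ht)⟩
    set A : Set (S → L) := {y | ∀ (t : G) (ht : t ∈ T),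
      y ⟨t, (hmS t ht).1⟩ = y ⟨g⁻¹ * t, (hmS t ht).2⟩} with hA
    set B : Set (({t, g⁻¹ * t} : Finset G) → L) :=
      {y | y ⟨t, by simp⟩ = y ⟨g⁻¹ * t, by simp⟩} with hBdef
    have h3 := h2.measure_inter_preimage_eq_mul A B A.toFinite.measurableSet
      B.toFinite.measurableSet
    have h4 : {x : G → L | ∀ u ∈ insert t T, x u = x (g⁻¹ * u)} =
        (fun (x : G → L) (i : S) => x i) ⁻¹' A ∩
          (fun (x : G → L) (i : ({t, g⁻¹ * t} : Finset G)) => x i) ⁻¹' B := by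
      ext x
      simp only [Finset.mem_insert, forall_eq_or_imp]
      exact and_comm
    rw [h4, h3, pow_succ]
    refine mul_le_mul' hT ?_
    exact (hB.measure_apply_eq_apply hne).le

theorem IsBernoulliProd.ae_shiftAct_ne [Infinite G] {lam : Measure L}
    [IsProbabilityMeasure lam] {μB : Measure (G → L)} (hB : IsBernoulliProd lam μB)
    (hne : ∀ ℓ, lam {ℓ} ≠ 1) {g : G} (hg : g ≠ 1) : μB {x | shiftAct g x = x} = 0 := by
  refine le_antisymm ?_ bot_le
  refine ge_of_tendsto' (ENNReal.tendsto_pow_atTop_nhds_zero_of_lt_one (sum_sq_lt_one hne))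
    fun n => ?_
  obtain ⟨T, hT⟩ := hB.exists_measure_le_pow hg n
  refine (measure_mono fun x hx t _ => ?_).trans hT
  exact (congrFun (show shiftAct g x = x from hx) t).symm

theorem measurable_stabMap [Countable G] : Measurable (stabMap G L) := by
  refine measurable_set_iff.2 fun g => measurableSet_setOfPred.1 ?_
  have h1 : {x : G → L | g ∈ stabMap G L x} = ⋂ t : G, {x | x (g⁻¹ * t) = x t} := by
    ext x
    rw [Set.mem_iInter]
    exact funext_iff
  rw [h1]
  refine MeasurableSet.iInter fun t => ?_
  have h2 : Measurable fun x : G → L => (x (g⁻¹ * t), x t) := by fun_prop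
  exact h2 (show MeasurableSet {z : L × L | z.1 = z.2} from (Set.toFinite _).measurableSet)

theorem measure_shiftAct_eq_of_map_stabMap_eq [Countable G] {κ μ : Measure (G → L)}
    (h : κ.map (stabMap G L) = μ.map (stabMap G L)) (g : G) :
    κ {x | shiftAct g x = x} = μ {x | shiftAct g x = x} := by
  have h1 : MeasurableSet {S : Set G | g ∈ S} :=
    measurableSet_setOfPred.2 (measurable_set_mem g)
  have h2 := congrArg (fun ν => ν {S : Set G | g ∈ S}) h
  simp only [Measure.map_apply measurable_stabMap h1] at h2
  exact h2

end Freeness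

/-! ### Bernoulli measures are finitely determined -/

theorem continuous_measureReal_letter {G L : Type*} [Countable G] [TopologicalSpace L]
    [Fintype L] [DiscreteTopology L] [MeasurableSpace L] [BorelSpace L] (g : G) (ℓ : L) :
    Continuous fun κ : ProbabilityMeasure (G → L) =>
      (κ : Measure (G → L)).real {x | x g = ℓ} := by
  have hclopen : IsClopen {x : G → L | x g = ℓ} :=
    (isClopen_discrete {ℓ}).preimage (continuous_apply g)
  let _ := TopologicalSpace.pseudoMetrizableSpacePseudoMetric (G → L)
  rw [continuous_iff_continuousAt]
  intro κ
  have h1 := ProbabilityMeasure.tendsto_measure_of_isClopen_of_tendsto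
    (Filter.tendsto_id (α := ProbabilityMeasure (G → L)) (x := nhds κ)) hclopen
  exact (NNReal.continuous_coe.tendsto _).comp h1

/-- An itinerary that separates the points of almost every orbit yields an order function. -/
theorem exists_measurable_order {G L : Type*} [Group G] [Countable G] [MeasurableSpace L]
    {κ : Measure (G → L)} {γ : (G → L) → ℕ}
    (hsep : ∀ g : G, g ≠ 1 → ∀ᵐ x ∂κ, ∃ h, γ (shiftAct h x) ≠ γ (shiftAct h (shiftAct g x))) :
    ∃ o : (G → L) → ℝ, Measurable[itinAlg γ] o ∧ (∀ x, 0 ≤ o x) ∧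
      ∀ g : G, g ≠ 1 → ∀ᵐ x ∂κ, o (shiftAct g x) ≠ o x := by
  obtain ⟨f, hf, hinj, hf0⟩ := exists_measurable_injective_nonneg (G → ℕ)
  refine ⟨fun x => f (itin γ x), hf.comp measurable_itin, fun x => hf0 _, fun g hg => ?_⟩
  filter_upwards [hsep g hg] with x ⟨h, hx⟩ heq
  exact hx (congrFun (hinj heq) h).symm

theorem dbar_le_of_measure_singleton_eq_one {G L : Type*} [Group G] [Countable G] [Fintype L]
    [MeasurableSpace L] [MeasurableSingletonClass L] {lam : Measure L} [IsProbabilityMeasure lam]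
    {μB : Measure (G → L)} (hB : IsBernoulliProd lam μB) {κ : Measure (G → L)}
    [IsProbabilityMeasure κ] (hinv : ∀ g : G, MeasurePreserving (shiftAct g) κ κ) {ℓ : L}
    (hℓ : lam {ℓ} = 1) :
    dbar G μB κ ≤ ENNReal.ofReal (tvDist (fun ℓ => (lam {ℓ}).toReal)
      fun ℓ => κ.real {x | x 1 = ℓ}) := by
  have := hB.1
  have hj : IsJoining G (μB.prod κ) μB κ := by
    refine ⟨fun g => ?_, ?_, ?_⟩
    · have h1 : MeasurePreserving (shiftAct g) μB μB := by
        rw [hB.eq_infinitePi]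
        exact measurePreserving_shiftAct_infinitePi lam g
      exact h1.prod (hinv g)
    · rw [Measure.map_fst_prod, measure_univ, one_smul]
    · rw [Measure.map_snd_prod, measure_univ, one_smul]
  refine (iInf₂_le (f := fun lam (_ : IsJoining G lam μB κ) => lam {z | z.1 1 ≠ z.2 1}) _
    hj).trans ?_
  have ha : Measurable fun x : G → L => x 1 := measurable_pi_apply 1
  have hμ : μB {x | x 1 = ℓ} = 1 := by
    have h1 := hB.2 {1} (fun _ => {ℓ}) fun _ => measurableSet_singleton ℓ
    simpa [hℓ] using h1
  have hμc : μB {x | x 1 = ℓ}ᶜ = 0 :=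
    (prob_compl_eq_zero_iff (measurableSet_letter ha ℓ)).2 hμ
  calc μB.prod κ {z | z.1 1 ≠ z.2 1}
      ≤ μB.prod κ ({x | x 1 = ℓ}ᶜ ×ˢ Set.univ ∪ Set.univ ×ˢ {x | x 1 = ℓ}ᶜ) := by
        refine measure_mono fun z hz => ?_
        by_contra h
        rw [Set.mem_union, not_or] at h
        have h1 : z.1 1 = ℓ := by
          by_contra h'
          exact h.1 ⟨h', Set.mem_univ _⟩
        have h2 : z.2 1 = ℓ := by
          by_contra h'
          exact h.2 ⟨Set.mem_univ _, h'⟩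
        exact hz (h1.trans h2.symm)
    _ ≤ κ {x | x 1 = ℓ}ᶜ := by
        refine (measure_union_le _ _).trans ?_
        rw [Measure.prod_prod, Measure.prod_prod, hμc, zero_mul, zero_add, measure_univ, one_mul]
    _ = ENNReal.ofReal (1 - κ.real {x | x 1 = ℓ}) := by
        rw [← probReal_compl_eq_one_sub (measurableSet_letter ha ℓ), ofReal_measureReal]
    _ ≤ _ := by
        refine ENNReal.ofReal_le_ofReal ?_
        have h1 := Finset.single_le_sum (f := fun a => max ((lam {a}).toReal -
          κ.real {x : G → L | x 1 = a}) 0) (fun a _ => le_max_right _ _) (Finset.mem_univ ℓ)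
        simp only [hℓ, ENNReal.toReal_one] at h1
        exact (le_max_left _ _).trans h1

theorem letterEnt_ne_top {X L : Type*} [Fintype L] {m : MeasurableSpace X}
    [mX : MeasurableSpace X] [StandardBorelSpace X] {κ : Measure X} [IsProbabilityMeasure κ]
    {a : X → L} : letterEnt m κ a ≠ ∞ := by
  refine ((lintegral_mono (g := fun _ => ∑ _ℓ : L, (1 : ℝ≥0∞)) fun x =>
    Finset.sum_le_sum fun ℓ _ => ?_).trans_lt ?_).ne
  · rw [← ENNReal.ofReal_one]
    refine ENNReal.ofReal_le_ofReal ?_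
    have h0 := letterProb_nonneg (m := m) (κ := κ) (a := a) ℓ x
    exact (Real.negMulLog_le_one_sub_self h0).trans (by linarith)
  · simp

theorem lintegral_tvDist_le_add {X L : Type*} [Fintype L] [MeasurableSpace L]
    [MeasurableSingletonClass L] {m : MeasurableSpace X} [mX : MeasurableSpace X]
    [StandardBorelSpace X] {κ : Measure X} [IsProbabilityMeasure κ] {a : X → L} (hm : m ≤ mX)
    (ha : Measurable a) (p : L → ℝ) {s h η : ℝ} (hs : 0 < s) (hη : 0 < η)
    (hent : ENNReal.ofReal h ≤ ENNReal.ofReal η + letterEnt m κ a) :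
    ∫⁻ x, ENNReal.ofReal (tvDist p fun ℓ => letterProb m κ a ℓ x) ∂κ ≤
      ENNReal.ofReal (tvDist p fun ℓ => κ.real {y | a y = ℓ}) +
        ENNReal.ofReal (4 * s + (∑ ℓ, Real.negMulLog (κ.real {y | a y = ℓ}) - (h - η)) /
          (4 * s)) := by
  have h1 : h - η ≤ (letterEnt m κ a).toReal := by
    rw [← ENNReal.ofReal_toReal (letterEnt_ne_top (m := m) (κ := κ) (a := a)),
      ← ENNReal.ofReal_add hη.le ENNReal.toReal_nonneg,
      ENNReal.ofReal_le_ofReal_iff (add_nonneg hη.le ENNReal.toReal_nonneg)] at hent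
    linarith
  set r : L → ℝ := fun ℓ => κ.real {y | a y = ℓ}
  calc ∫⁻ x, ENNReal.ofReal (tvDist p fun ℓ => letterProb m κ a ℓ x) ∂κ
      ≤ ∫⁻ x, (ENNReal.ofReal (tvDist p r) +
          ENNReal.ofReal (tvDist r fun ℓ => letterProb m κ a ℓ x)) ∂κ := by
        refine lintegral_mono fun x => ?_
        rw [← ENNReal.ofReal_add (tvDist_nonneg _ _) (tvDist_nonneg _ _)]
        exact ENNReal.ofReal_le_ofReal (tvDist_triangle _ _ _)
    _ = ENNReal.ofReal (tvDist p r) +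
          ∫⁻ x, ENNReal.ofReal (tvDist r fun ℓ => letterProb m κ a ℓ x) ∂κ := by
        rw [lintegral_add_left measurable_const, lintegral_const, measure_univ, mul_one]
    _ ≤ ENNReal.ofReal (tvDist p r) + ENNReal.ofReal (4 * s +
          (∑ ℓ, Real.negMulLog (r ℓ) - (letterEnt m κ a).toReal) / (4 * s)) :=
        add_le_add_right (lintegral_tvDist_letterProb_le hm ha hs) _
    _ ≤ _ := by
        refine add_le_add_right (ENNReal.ofReal_le_ofReal (add_le_add_right ?_ _)) _
        exact div_le_div_of_nonneg_right (by linarith) (by positivity)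

/-- The d-bar distance to a Bernoulli measure is controlled by the single-letter total variation
distance and by the deficit of Rokhlin entropy from single-letter entropy. -/
theorem dbar_le_of_free {G L : Type*} [Group G] [Countable G] [Infinite G] [Fintype L]
    [Nonempty L] [MeasurableSpace L] [MeasurableSingletonClass L] [StandardBorelSpace L]
    {lam : Measure L} [IsProbabilityMeasure lam] {μB : Measure (G → L)}
    (hB : IsBernoulliProd lam μB) {κ : Measure (G → L)} [IsProbabilityMeasure κ]
    (hinv : ∀ g : G, MeasurePreserving (shiftAct g) κ κ)
    (hfree : ∀ g : G, g ≠ 1 → ∀ᵐ x ∂κ, shiftAct g x ≠ x) {s η h : ℝ} (hs : 0 < s) (hη : 0 < η)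
    (hh : ENNReal.ofReal h ≤ rokhlinShift G κ) :
    dbar G μB κ ≤ ENNReal.ofReal (tvDist (fun ℓ => (lam {ℓ}).toReal)
        fun ℓ => κ.real {x | x 1 = ℓ}) +
      ENNReal.ofReal (4 * s +
        (∑ ℓ, Real.negMulLog (κ.real {x | x 1 = ℓ}) - (h - η)) / (4 * s)) := by
  obtain ⟨γ, A, hγ, hA, hAη, hsep⟩ := exists_separating_code hinv hfree hη
  obtain ⟨o, ho, ho0, hosep⟩ := exists_measurable_order hsep
  exact (dbar_le_lintegral_tvDist hB hinv hγ ho hosep).trans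
    (lintegral_tvDist_le_add (pastAlg_le_borel hγ ho) (measurable_pi_apply 1) _ hs hη
      (hh.trans ((rokhlinShift_le_letterEnt hinv hγ hA ho ho0 hosep).trans
        (add_le_add_left hAη _))))

/-- **Bernoulli measures of maximal Rokhlin entropy are finitely determined**: if `G` is a
countably infinite group, `(L, λ)` is a finite probability space and the Bernoulli measure
`λ^G` satisfies `rh_G(L^G, λ^G) = H(L, λ)`, then `λ^G` is finitely determined: for every
`ε > 0` there are `δ > 0` and a weak*-open neighborhood `U` of `λ^G` such that every
shift-invariant probability measure in `U` with the same stabilizer type and Rokhlin entropy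
within `δ` of `rh_G(L^G, λ^G)` is within d-bar distance `ε` of `λ^G`. -/
theorem bernoulli_finitely_determined
    {G L : Type*} [Group G] [Countable G] [Infinite G]
    [Fintype L] [TopologicalSpace L] [DiscreteTopology L] [MeasurableSpace L] [BorelSpace L]
    (lam : Measure L) [IsProbabilityMeasure lam]
    (μB : Measure (G → L)) (hB : IsBernoulliProd lam μB)
    (hent : rokhlinShift G μB =
      ∑' ℓ : L, ENNReal.ofReal (Real.negMulLog (lam {ℓ}).toReal)) :
    ∀ ε : ℝ, 0 < ε → ∃ δ : ℝ, 0 < δ ∧ ∃ U : Set (ProbabilityMeasure (G → L)),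
      IsOpen U ∧
      (∀ κ : ProbabilityMeasure (G → L), (κ : Measure (G → L)) = μB → κ ∈ U) ∧
      ∀ κ : ProbabilityMeasure (G → L), κ ∈ U →
        (∀ g : G, MeasurePreserving (shiftAct g)
          (κ : Measure (G → L)) (κ : Measure (G → L))) →
        Measure.map (stabMap G L) (κ : Measure (G → L)) = Measure.map (stabMap G L) μB →
        ediff (rokhlinShift G (κ : Measure (G → L))) (rokhlinShift G μB) < ENNReal.ofReal δ →
        dbar G μB (κ : Measure (G → L)) < ENNReal.ofReal ε := by
  intro ε hε
  have : Nonempty L := by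
    by_contra h
    rw [not_nonempty_iff] at h
    have h1 : lam Set.univ = 1 := measure_univ
    rw [Set.univ_eq_empty_iff.2 h, measure_empty] at h1
    exact zero_ne_one h1
  set p : L → ℝ := fun ℓ => (lam {ℓ}).toReal with hp
  set H : ℝ := ∑ ℓ, Real.negMulLog (p ℓ) with hH
  have hHμ : rokhlinShift G μB = ENNReal.ofReal H := by
    rw [hent, tsum_fintype, hH, ENNReal.ofReal_sum_of_nonneg]
    exact fun ℓ _ => Real.negMulLog_nonneg ENNReal.toReal_nonneg
      (ENNReal.toReal_le_of_le_ofReal zero_le_one (by simpa using prob_le_one))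
  set d : ℝ := ε ^ 2 / 64 with hd
  have hd0 : 0 < d := by positivity
  have hletter : ∀ κ : ProbabilityMeasure (G → L), (κ : Measure (G → L)) = μB →
      (fun ℓ => (κ : Measure (G → L)).real {x | x 1 = ℓ}) = p := by
    intro κ hκ
    funext ℓ
    have h1 := hB.2 {1} (fun _ => {ℓ}) fun _ => measurableSet_singleton ℓ
    simp only [Finset.mem_singleton, forall_eq, Set.mem_singleton_iff,
      Finset.prod_singleton] at h1
    simp only [Measure.real, hκ, h1, hp]
  set r : ProbabilityMeasure (G → L) → L → ℝ := fun κ ℓ =>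
    (κ : Measure (G → L)).real {x | x 1 = ℓ} with hr
  have hrc : Continuous r := continuous_pi fun ℓ => continuous_measureReal_letter 1 ℓ
  have htv : Continuous fun v : L → ℝ => tvDist p v := by
    unfold tvDist
    fun_prop
  have hnl : Continuous fun v : L → ℝ => ∑ ℓ, Real.negMulLog (v ℓ) :=
    continuous_finsetSum _ fun ℓ _ => Real.continuous_negMulLog.comp (continuous_apply ℓ)
  refine ⟨d, hd0, {κ | tvDist p (r κ) < ε / 4} ∩ {κ | ∑ ℓ, Real.negMulLog (r κ ℓ) < H + d},
    (isOpen_lt (htv.comp hrc) continuous_const).inter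
      (isOpen_lt (hnl.comp hrc) continuous_const), fun κ hκ => ⟨?_, ?_⟩, ?_⟩
  · change tvDist p (r κ) < ε / 4
    rw [show r κ = p from hletter κ hκ]
    simpa [tvDist] using hε
  · change ∑ ℓ, Real.negMulLog (r κ ℓ) < H + d
    rw [show r κ = p from hletter κ hκ]
    linarith
  rintro κ ⟨hκtv, hκH⟩ hinv hstab hdiff
  change tvDist p (r κ) < ε / 4 at hκtv
  change ∑ ℓ, Real.negMulLog (r κ ℓ) < H + d at hκH
  by_cases hpoint : ∃ ℓ, lam {ℓ} = 1
  · obtain ⟨ℓ, hℓ⟩ := hpoint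
    refine (dbar_le_of_measure_singleton_eq_one hB hinv hℓ).trans_lt ?_
    exact (ENNReal.ofReal_lt_ofReal_iff hε).2 (hκtv.trans (by linarith))
  push Not at hpoint
  have hfree : ∀ g : G, g ≠ 1 → ∀ᵐ x ∂(κ : Measure (G → L)), shiftAct g x ≠ x := by
    intro g hg
    rw [ae_iff]
    simp only [not_not]
    rw [measure_shiftAct_eq_of_map_stabMap_eq hstab, hB.ae_shiftAct_ne hpoint hg]
  have hh : ENNReal.ofReal (H - d) ≤ rokhlinShift G (κ : Measure (G → L)) := by
    rw [ENNReal.ofReal_sub _ hd0.le, tsub_le_iff_right, ← hHμ, add_comm]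
    exact tsub_le_iff_right.1 ((le_add_self.trans hdiff.le))
  refine (dbar_le_of_free hB hinv hfree (s := ε / 16) (by positivity) hd0 hh).trans_lt ?_
  have h1 : 4 * (ε / 16) + (∑ ℓ, Real.negMulLog (r κ ℓ) - (H - d - d)) / (4 * (ε / 16)) ≤
      ε / 2 := by
    have h2 : (∑ ℓ, Real.negMulLog (r κ ℓ) - (H - d - d)) / (4 * (ε / 16)) ≤ ε / 4 := by
      rw [div_le_iff₀ (by positivity)]
      nlinarith
    linarith
  calc _ ≤ ENNReal.ofReal (ε / 4) + ENNReal.ofReal (ε / 2) :=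
        add_le_add (ENNReal.ofReal_le_ofReal hκtv.le) (ENNReal.ofReal_le_ofReal h1)
    _ = ENNReal.ofReal (ε / 4 + ε / 2) :=
        (ENNReal.ofReal_add (by positivity) (by positivity)).symm
    _ < ENNReal.ofReal ε := (ENNReal.ofReal_lt_ofReal_iff hε).2 (by linarith)
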